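/- For all A, B ⊆ ℕ: A ≤_LR B if and only if A ≤_LK B. -/

import Mathlib

open MeasureTheory Filter

namespace LMD

/-- Codes for partial functions recursive in an oracle. -/
inductive OracleCode : Type
  | zero : OracleCode
  | succ : OracleCode
  | left : OracleCode
  | right : OracleCode
  | oracle : OracleCode
  | pair : OracleCode → OracleCode → OracleCode
  | comp : OracleCode → OracleCode → OracleCode
  | prec : OracleCode → OracleCode → OracleCode
  | rfind' : OracleCode → OracleCode

namespace OracleCode

/-- Evaluation of an oracle code relative to a (total) oracle `O : ℕ → ℕ`. -/
def eval (O : ℕ → ℕ) : OracleCode → ℕ →. ℕ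
  | zero => pure 0
  | succ => Nat.succ
  | left => ↑fun n : ℕ => n.unpair.1
  | right => ↑fun n : ℕ => n.unpair.2
  | oracle => ↑fun n : ℕ => O n
  | pair cf cg => fun n => Nat.pair <$> eval O cf n <*> eval O cg n
  | comp cf cg => fun n => eval O cg n >>= eval O cf
  | prec cf cg =>
    Nat.unpaired fun a n =>
      n.rec (eval O cf a) fun y IH => do
        let i ← IH
        eval O cg (Nat.pair a (Nat.pair y i))
  | rfind' cf =>
    Nat.unpaired fun a m =>
      (Nat.rfind fun n => (fun m => m = 0) <$> eval O cf (Nat.pair a (n + m))).map (· + m)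

/-- A Gödel numbering of oracle codes. -/
def encodeCode : OracleCode → ℕ
  | zero => 0
  | succ => 1
  | left => 2
  | right => 3
  | oracle => 4
  | pair cf cg => 4 * Nat.pair (encodeCode cf) (encodeCode cg) + 5
  | comp cf cg => 4 * Nat.pair (encodeCode cf) (encodeCode cg) + 6
  | prec cf cg => 4 * Nat.pair (encodeCode cf) (encodeCode cg) + 7
  | rfind' cf => 4 * encodeCode cf + 8

end OracleCode

/-- `f` is partial recursive in the oracle `O`. -/
def RecursiveIn (O : ℕ → ℕ) (f : ℕ →. ℕ) : Prop := ∃ c : OracleCode, c.eval O = f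

/-- The characteristic function of a set of naturals. -/
noncomputable def chi (A : Set ℕ) : ℕ → ℕ := A.indicator fun _ => 1

/-- Turing reducibility between sets of naturals. -/
def TuringLE (A B : Set ℕ) : Prop := RecursiveIn (chi B) (chi A)

/-- The Turing jump of a set of naturals. -/
def jump (B : Set ℕ) : Set ℕ :=
  {e | ∃ c : OracleCode, c.encodeCode = e ∧ (c.eval (chi B) e).Dom}

/-- The open subset of Cantor space generated by a set of finite binary strings. -/
def Cyl (W : Set (List Bool)) : Set (ℕ → Bool) :=
  {X | ∃ σ ∈ W, ∀ i : Fin σ.length, X i = σ.get i}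

/-- The fair-coin product measure on Cantor space, realized as the pushforward of
Lebesgue measure on `[0,1)` under the binary expansion map. -/
noncomputable def mu : Measure (ℕ → Bool) :=
  Measure.map (fun x n => decide (⌊x * 2 ^ (n + 1)⌋₊ % 2 = 1))
    (volume.restrict (Set.Ico (0 : ℝ) 1))

/-- `W` is a c.e.-in-`A` set of binary strings. -/
def CeIn (A : Set ℕ) (W : Set (List Bool)) : Prop :=
  ∃ c : OracleCode, ∀ σ : List Bool, σ ∈ W ↔ (c.eval (chi A) (Encodable.encode σ)).Dom

/-- `W` is a uniformly c.e.-in-`A` sequence of sets of binary strings. -/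
def CeSeqIn (A : Set ℕ) (W : ℕ → Set (List Bool)) : Prop :=
  ∃ c : OracleCode, ∀ (n : ℕ) (σ : List Bool),
    σ ∈ W n ↔ (c.eval (chi A) (Nat.pair n (Encodable.encode σ))).Dom

/-- A Martin-Löf test relative to `A`. -/
def MLTest (A : Set ℕ) (U : ℕ → Set (ℕ → Bool)) : Prop :=
  ∃ W : ℕ → Set (List Bool), CeSeqIn A W ∧ (∀ n, U n = Cyl (W n)) ∧
    (∀ n, U (n + 1) ⊆ U n) ∧ ∀ n, mu (U n) ≤ 2⁻¹ ^ n

/-- `X` is Martin-Löf random relative to `A`. -/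
def MLRandom (A : Set ℕ) (X : ℕ → Bool) : Prop :=
  ∀ U : ℕ → Set (ℕ → Bool), MLTest A U → X ∉ ⋂ n, U n

/-- `A ≤_LR B`: every `B`-random is `A`-random. -/
def LRle (A B : Set ℕ) : Prop := ∀ X : ℕ → Bool, MLRandom B X → MLRandom A X

/-- Evaluation of an oracle machine on binary strings. -/
def evalStr (c : OracleCode) (O : ℕ → ℕ) (σ : List Bool) : Part (List Bool) :=
  (c.eval O (Encodable.encode σ)).bind fun m => Part.ofOption (Encodable.decode m)

/-- `c` is a prefix-free oracle machine: for every oracle its domain is prefix-free. -/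
def PrefixFreeMachine (c : OracleCode) : Prop :=
  ∀ (O : ℕ → ℕ) (σ₁ σ₂ : List Bool), σ₁ <+: σ₂ →
    (evalStr c O σ₁).Dom → (evalStr c O σ₂).Dom → σ₁ = σ₂

/-- `u` is a universal prefix-free oracle machine. -/
def UniversalPFM (u : OracleCode) : Prop :=
  PrefixFreeMachine u ∧
    ∀ c : OracleCode, PrefixFreeMachine c → ∃ d : ℕ, ∀ (O : ℕ → ℕ) (σ τ : List Bool),
      τ ∈ evalStr c O σ → ∃ σ' : List Bool, τ ∈ evalStr u O σ' ∧ σ'.length ≤ σ.length + d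

/-- Prefix-free Kolmogorov complexity relative to the oracle `O`,
measured by the universal machine `u` (`⊤` if `τ` is not in the range). -/
noncomputable def K (u : OracleCode) (O : ℕ → ℕ) (τ : List Bool) : ℕ∞ :=
  ⨅ σ ∈ {σ : List Bool | τ ∈ evalStr u O σ}, (σ.length : ℕ∞)

/-- `A ≤_LK B` with respect to the universal machine `u`. -/
def LKle (u : OracleCode) (A B : Set ℕ) : Prop :=
  ∃ d : ℕ, ∀ τ : List Bool, K u (chi B) τ ≤ K u (chi A) τ + (d : ℕ∞)

namespace OracleCode

@[simp] theorem some_bind_eval (O : ℕ → ℕ) (c : OracleCode) (n : ℕ) :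
    (Part.some n).bind (eval O c) = eval O c n := Part.bind_some _ _

theorem bind_bind_eval (O : ℕ → ℕ) (c : OracleCode) (x : Part ℕ) (f : ℕ → Part ℕ) :
    (x.bind f).bind (eval O c) = x.bind fun a => (f a).bind (eval O c) := Part.bind_assoc _ _ _

theorem eval_zero (O : ℕ → ℕ) (n : ℕ) : eval O zero n = Part.some 0 := rfl

theorem eval_succ (O : ℕ → ℕ) (n : ℕ) : eval O succ n = Part.some (n + 1) := rfl

theorem eval_left (O : ℕ → ℕ) (n : ℕ) : eval O left n = Part.some n.unpair.1 := rfl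

theorem eval_right (O : ℕ → ℕ) (n : ℕ) : eval O right n = Part.some n.unpair.2 := rfl

theorem eval_oracle (O : ℕ → ℕ) (n : ℕ) : eval O oracle n = Part.some (O n) := rfl

theorem eval_comp (O : ℕ → ℕ) (c d : OracleCode) (n : ℕ) :
    eval O (comp c d) n = (eval O d n).bind (eval O c) := rfl

theorem eval_pair (O : ℕ → ℕ) (c d : OracleCode) (n : ℕ) :
    eval O (pair c d) n =
      (eval O c n).bind fun a => (eval O d n).bind fun b => Part.some (Nat.pair a b) := by
  simp [eval, Seq.seq, Part.bind_some_eq_map]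

theorem eval_prec_zero (O : ℕ → ℕ) (c d : OracleCode) (n : ℕ) :
    eval O (prec c d) (Nat.pair n 0) = eval O c n := by
  simp [eval]

theorem eval_prec_succ (O : ℕ → ℕ) (c d : OracleCode) (n k : ℕ) :
    eval O (prec c d) (Nat.pair n (k + 1)) =
      (eval O (prec c d) (Nat.pair n k)).bind fun i => eval O d (Nat.pair n (Nat.pair k i)) := by
  simp [eval]

theorem eval_rfind' (O : ℕ → ℕ) (c : OracleCode) (n m : ℕ) :
    eval O (rfind' c) (Nat.pair n m) =
      (Nat.rfind fun k => (eval O c (Nat.pair n (k + m))).map fun y => decide (y = 0)).map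
        (· + m) := by
  simp [eval]

/-- Every primitive recursive function has a code that works for all oracles. -/
theorem exists_code_of_primrec {f : ℕ → ℕ} (hf : Nat.Primrec f) :
    ∃ c : OracleCode, ∀ O n, eval O c n = Part.some (f n) := by
  induction hf with
  | zero => exact ⟨zero, fun O n => rfl⟩
  | succ => exact ⟨succ, fun O n => rfl⟩
  | left => exact ⟨left, fun O n => rfl⟩
  | right => exact ⟨right, fun O n => rfl⟩
  | pair _ _ hf hg =>
    obtain ⟨c, hc⟩ := hf
    obtain ⟨d, hd⟩ := hg
    exact ⟨pair c d, fun O n => by simp [eval_pair, hc, hd]⟩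
  | comp _ _ hf hg =>
    obtain ⟨c, hc⟩ := hf
    obtain ⟨d, hd⟩ := hg
    exact ⟨comp c d, fun O n => by simp [eval_comp, hc, hd]⟩
  | prec _ _ hf hg =>
    obtain ⟨c, hc⟩ := hf
    obtain ⟨d, hd⟩ := hg
    refine ⟨prec c d, fun O n => ?_⟩
    rw [← Nat.pair_unpair n]
    simp only [Nat.unpaired, Nat.unpair_pair]
    induction n.unpair.2 with
    | zero => simp [eval_prec_zero, hc]
    | succ k ih => simp [eval_prec_succ, ih, hd]

theorem exists_code_of_primrec' {f : ℕ → ℕ} (hf : Primrec f) :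
    ∃ c : OracleCode, ∀ O n, eval O c n = Part.some (f n) :=
  exists_code_of_primrec (Primrec.nat_iff.1 hf)

end OracleCode

/-- The initial segment of length `s` of a sequence. -/
def res {α : Type*} (O : ℕ → α) (s : ℕ) : List α := (List.range s).map O

section res

variable {α : Type*} (O : ℕ → α)

@[simp] theorem length_res (s : ℕ) : (res O s).length = s := by simp [res]

@[simp] theorem res_zero : res O 0 = [] := rfl

theorem res_succ (s : ℕ) : res O (s + 1) = res O s ++ [O s] := by
  simp [res, List.range_succ]

theorem take_res {s t : ℕ} (h : t ≤ s) : (res O s).take t = res O t := by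
  simp [res, List.take_range, ← List.map_take, h]

theorem res_prefix {s t : ℕ} (h : t ≤ s) : res O t <+: res O s := by
  rw [← take_res O h]
  exact List.take_prefix _ _

theorem eq_res_of_prefix {O : ℕ → α} {s : ℕ} {l : List α} (h : l <+: res O s) :
    l = res O l.length := by
  have hl := h.length_le
  rw [length_res] at hl
  rw [← take_res O hl]
  exact List.prefix_iff_eq_take.1 h

theorem getElem?_res {s i : ℕ} (h : i < s) : (res O s)[i]? = some (O i) := by
  simp [res, h]

end res

namespace OracleCode

/-- A code computing oracle initial segments. -/
theorem exists_code_res :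
    ∃ c : OracleCode, ∀ O n s,
      eval O c (Nat.pair n s) = Part.some (Encodable.encode (res O s).reverse) := by
  obtain ⟨d, hd⟩ := exists_code_of_primrec'
    (f := fun m => Nat.succ (Nat.pair m.unpair.1 m.unpair.2)) (by
      exact Primrec.succ.comp (Primrec₂.natPair.comp (Primrec.fst.comp Primrec.unpair)
        (Primrec.snd.comp Primrec.unpair)))
  refine ⟨prec zero (comp d (pair (comp oracle (comp left right)) (comp right right))),
    fun O n s => ?_⟩
  induction s with
  | zero => simp [res, eval_prec_zero, eval_zero]
  | succ k ih =>
    simp [eval_prec_succ, ih, res_succ, eval_comp, eval_pair, eval_oracle, eval_left, eval_right,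
      hd]

/-- Unbounded search over oracle initial segments has a code. -/
theorem exists_code_search {g : ℕ → List ℕ → Option ℕ} (hg : Primrec₂ g) :
    ∃ c : OracleCode, ∀ O n,
      (∀ y, y ∈ eval O c n → ∃ s, g n (res O s) = some y) ∧
      (∀ s, (g n (res O s)).isSome → (eval O c n).Dom) := by
  obtain ⟨r, hr⟩ := exists_code_res
  let G : ℕ → Option ℕ := fun m =>
    g m.unpair.1 (((Encodable.decode m.unpair.2 : Option (List ℕ)).getD []).reverse)
  have hG : Primrec G := by
    refine hg.comp (Primrec.fst.comp Primrec.unpair) (Primrec.list_reverse.comp ?_)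
    exact Primrec.option_getD.comp (Primrec.decode.comp (Primrec.snd.comp Primrec.unpair))
      (Primrec.const [])
  obtain ⟨t, ht⟩ := exists_code_of_primrec' (f := fun m => if (G m).isSome then 0 else 1)
    (Primrec.ite (Primrec.eq.comp (Primrec.option_isSome.comp hG) (Primrec.const true))
      (Primrec.const 0) (Primrec.const 1))
  obtain ⟨v, hv⟩ := exists_code_of_primrec' (f := fun m => (G m).getD 0)
    (Primrec.option_getD.comp hG (Primrec.const 0))
  obtain ⟨i, hi⟩ := exists_code_of_primrec' (f := fun m => m) Primrec.id
  let q : OracleCode := pair left r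
  have hq : ∀ O n s, eval O q (Nat.pair n s) =
      Part.some (Nat.pair n (Encodable.encode (res O s).reverse)) := by
    intro O n s
    simp [q, eval_pair, eval_left, hr]
  have hGq : ∀ O n s, G (Nat.pair n (Encodable.encode (res O s).reverse)) = g n (res O s) := by
    intro O n s
    simp [G]
  let f : OracleCode := comp (rfind' (comp t q)) (pair i zero)
  have hf : ∀ O n, eval O f n =
      Nat.rfind (fun s => Part.some (decide ((g n (res O s)).isSome = true))) := by
    intro O n
    have h1 : ∀ m : ℕ, (if (g n (res O m)).isSome = true then 0 else 1) = 0 ↔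
        (g n (res O m)).isSome = true := fun m => by split_ifs with h <;> simp [h]
    simp [f, eval_comp, eval_pair, eval_zero, hi, eval_rfind', hq, ht, hGq, h1]
    exact Part.map_id' (fun _ => rfl) _
  refine ⟨comp (comp v q) (pair i f), fun O n => ?_⟩
  have he : eval O (comp (comp v q) (pair i f)) n =
      (Nat.rfind (fun s => Part.some (decide ((g n (res O s)).isSome = true)))).bind
        fun s => Part.some ((g n (res O s)).getD 0) := by
    simp [eval_comp, eval_pair, hi, hf, bind_bind_eval, hq, hv, hGq]
  constructor
  · intro y hy
    rw [he, Part.mem_bind_iff] at hy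
    obtain ⟨s, hs, hy⟩ := hy
    have := Nat.rfind_spec hs
    simp at this hy
    obtain ⟨z, hz⟩ := Option.isSome_iff_exists.1 this
    exact ⟨s, by simp [hy, hz]⟩
  · intro s hs
    rw [he, Part.bind_dom]
    refine ⟨Nat.rfind_dom.2 ⟨s, by simpa using hs, fun _ => trivial⟩, trivial⟩

end OracleCode

namespace OracleCode

/-- `g` is a primitive recursive monotone approximation, by finite parts of the oracle, of the
functional with code `c`. -/
structure Approx (c : OracleCode) (g : ℕ → List ℕ → Option ℕ) : Prop where
  primrec : Primrec₂ g
  mono : ∀ {n l l' y}, l <+: l' → g n l = some y → g n l' = some y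
  sound : ∀ {O n s y}, g n (res O s) = some y → y ∈ eval O c n
  complete : ∀ {O n y}, y ∈ eval O c n → ∃ s, g n (res O s) = some y

theorem Approx.of_total {c : OracleCode} {f : ℕ → ℕ} (hf : Primrec f)
    (hc : ∀ O n, eval O c n = Part.some (f n)) : Approx c fun n _ => some (f n) where
  primrec := Primrec.option_some.comp (hf.comp Primrec.fst)
  mono := by simp
  sound := by
    intro O n s y h
    simp_all
  complete := by
    intro O n y h
    simp_all

theorem approx_oracle : Approx oracle fun n l => l[n]? where
  primrec := Primrec.list_getElem?.comp Primrec.snd Primrec.fst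
  mono := by
    rintro n l _ y ⟨r, rfl⟩ h
    have := (List.getElem?_eq_some_iff.1 h).1
    rw [List.getElem?_append_left this, h]
  sound := by
    intro O n s y h
    rw [eval_oracle]
    simp only [res, List.getElem?_map, Option.map_eq_some_iff, List.getElem?_eq_some_iff] at h
    obtain ⟨a, ⟨_, h⟩, rfl⟩ := h
    simp at h
    simp [h]
  complete := by
    intro O n y h
    rw [eval_oracle, Part.mem_some_iff] at h
    exact ⟨n + 1, by simp [res, h]⟩

theorem Approx.exists_common {c d : OracleCode} {g h : ℕ → List ℕ → Option ℕ}
    (hg : Approx c g) (hh : Approx d h) {O : ℕ → ℕ} {n m y z : ℕ} (hy : y ∈ eval O c n)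
    (hz : z ∈ eval O d m) : ∃ s, g n (res O s) = some y ∧ h m (res O s) = some z := by
  obtain ⟨s, hs⟩ := hg.complete hy
  obtain ⟨t, ht⟩ := hh.complete hz
  exact ⟨max s t, hg.mono (res_prefix O (le_max_left s t)) hs,
    hh.mono (res_prefix O (le_max_right s t)) ht⟩

theorem Approx.pair {c d : OracleCode} {g h : ℕ → List ℕ → Option ℕ}
    (hg : Approx c g) (hh : Approx d h) :
    Approx (pair c d) fun n l => (g n l).bind fun a => (h n l).map fun b => Nat.pair a b where
  primrec := by
    refine Primrec.option_bind hg.primrec ?_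
    refine Primrec.option_map (hh.primrec.comp (Primrec.fst.comp Primrec.fst)
      (Primrec.snd.comp Primrec.fst)) ?_
    exact Primrec₂.natPair.comp (Primrec.snd.comp Primrec.fst) Primrec.snd
  mono := by
    intro n l l' y hl hy
    simp only [Option.bind_eq_some_iff, Option.map_eq_some_iff] at hy ⊢
    obtain ⟨a, ha, b, hb, rfl⟩ := hy
    exact ⟨a, hg.mono hl ha, b, hh.mono hl hb, rfl⟩
  sound := by
    intro O n s y hy
    simp only [Option.bind_eq_some_iff, Option.map_eq_some_iff] at hy
    obtain ⟨a, ha, b, hb, rfl⟩ := hy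
    rw [eval_pair]
    simp only [Part.mem_bind_iff, Part.mem_some_iff]
    exact ⟨a, hg.sound ha, b, hh.sound hb, rfl⟩
  complete := by
    intro O n y hy
    rw [eval_pair] at hy
    simp only [Part.mem_bind_iff, Part.mem_some_iff] at hy
    obtain ⟨a, ha, b, hb, rfl⟩ := hy
    obtain ⟨s, h1, h2⟩ := hg.exists_common hh ha hb
    exact ⟨s, by simp [h1, h2]⟩

theorem Approx.comp {c d : OracleCode} {g h : ℕ → List ℕ → Option ℕ}
    (hg : Approx c g) (hh : Approx d h) :
    Approx (comp c d) fun n l => (h n l).bind fun a => g a l where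
  primrec := by
    refine Primrec.option_bind hh.primrec ?_
    exact hg.primrec.comp Primrec.snd (Primrec.snd.comp Primrec.fst)
  mono := by
    intro n l l' y hl hy
    simp only [Option.bind_eq_some_iff] at hy ⊢
    obtain ⟨a, ha, hb⟩ := hy
    exact ⟨a, hh.mono hl ha, hg.mono hl hb⟩
  sound := by
    intro O n s y hy
    simp only [Option.bind_eq_some_iff] at hy
    obtain ⟨a, ha, hb⟩ := hy
    rw [eval_comp]
    exact Part.mem_bind (hh.sound ha) (hg.sound hb)
  complete := by
    intro O n y hy
    rw [eval_comp] at hy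
    obtain ⟨a, ha, hb⟩ := Part.mem_bind_iff.1 hy
    obtain ⟨s, h1, h2⟩ := hh.exists_common hg ha hb
    exact ⟨s, by simp [h1, h2]⟩

/-- The approximation to a primitive recursion. -/
def precApprox (g h : ℕ → List ℕ → Option ℕ) (n : ℕ) (l : List ℕ) : Option ℕ :=
  n.unpair.2.rec (g n.unpair.1 l) fun y IH =>
    IH.bind fun i => h (Nat.pair n.unpair.1 (Nat.pair y i)) l

theorem precApprox_mono {c d : OracleCode} {g h : ℕ → List ℕ → Option ℕ}
    (hg : Approx c g) (hh : Approx d h) {n : ℕ} {l l' : List ℕ} {y : ℕ} (hl : l <+: l') :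
    precApprox g h n l = some y → precApprox g h n l' = some y := by
  unfold precApprox
  generalize n.unpair.1 = a
  generalize n.unpair.2 = k
  induction k generalizing y with
  | zero => exact hg.mono hl
  | succ k ih =>
    intro hy
    simp only [Option.bind_eq_some_iff] at hy ⊢
    obtain ⟨i, hi, hy⟩ := hy
    exact ⟨i, ih hi, hh.mono hl hy⟩

theorem Approx.prec {c d : OracleCode} {g h : ℕ → List ℕ → Option ℕ}
    (hg : Approx c g) (hh : Approx d h) : Approx (prec c d) (precApprox g h) where
  primrec := by
    have h1 : Primrec fun p : ℕ × List ℕ => p.1.unpair.1 :=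
      Primrec.fst.comp (Primrec.unpair.comp Primrec.fst)
    refine (Primrec.nat_rec' (f := fun p : ℕ × List ℕ => p.1.unpair.2)
      (g := fun p : ℕ × List ℕ => g p.1.unpair.1 p.2)
      (h := fun p q => q.2.bind fun i => h (Nat.pair p.1.unpair.1 (Nat.pair q.1 i)) p.2)
      (Primrec.snd.comp (Primrec.unpair.comp Primrec.fst))
      (hg.primrec.comp h1 Primrec.snd) ?_).of_eq fun _ => rfl
    refine Primrec.option_bind (Primrec.snd.comp Primrec.snd) ?_
    refine hh.primrec.comp ?_ (Primrec.snd.comp (Primrec.fst.comp Primrec.fst))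
    exact Primrec₂.natPair.comp (h1.comp (Primrec.fst.comp Primrec.fst))
      (Primrec₂.natPair.comp (Primrec.fst.comp (Primrec.snd.comp Primrec.fst)) Primrec.snd)
  mono := fun hl => precApprox_mono hg hh hl
  sound := by
    intro O n s y
    rw [← Nat.pair_unpair n]
    unfold precApprox
    simp only [Nat.unpair_pair]
    generalize n.unpair.1 = a
    generalize n.unpair.2 = k
    induction k generalizing y with
    | zero =>
      rw [eval_prec_zero]
      exact hg.sound
    | succ k ih =>
      intro hy
      simp only [Option.bind_eq_some_iff] at hy
      obtain ⟨i, hi, hy⟩ := hy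
      rw [eval_prec_succ]
      exact Part.mem_bind (ih hi) (hh.sound hy)
  complete := by
    intro O n y
    rw [← Nat.pair_unpair n]
    generalize n.unpair.1 = a
    generalize n.unpair.2 = k
    induction k generalizing y with
    | zero =>
      rw [eval_prec_zero]
      simpa [precApprox] using hg.complete
    | succ k ih =>
      intro hy
      rw [eval_prec_succ, Part.mem_bind_iff] at hy
      obtain ⟨i, hi, hy⟩ := hy
      obtain ⟨s, hs⟩ := ih hi
      obtain ⟨t, ht⟩ := hh.complete hy
      refine ⟨max s t, ?_⟩
      have h1 := precApprox_mono hg hh (res_prefix O (le_max_left s t)) hs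
      have h2 := hh.mono (res_prefix O (le_max_right s t)) ht
      simp only [precApprox, Nat.unpair_pair] at h1 ⊢
      rw [h1]
      exact h2

/-- The approximation to an unbounded search. -/
def rfindApprox (g : ℕ → List ℕ → Option ℕ) (n : ℕ) (l : List ℕ) : Option ℕ :=
  let i := (List.range l.length).findIdx fun k =>
    decide ((g (Nat.pair n.unpair.1 (k + n.unpair.2)) l).getD 0 = 0)
  if i < l.length ∧ g (Nat.pair n.unpair.1 (i + n.unpair.2)) l = some 0 then
    some (i + n.unpair.2) else none

theorem rfindApprox_eq_some {g : ℕ → List ℕ → Option ℕ} {a m y : ℕ} {l : List ℕ}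
    (h : rfindApprox g (Nat.pair a m) l = some y) :
    ∃ i < l.length, y = i + m ∧ g (Nat.pair a (i + m)) l = some 0 ∧
      ∀ k < i, ∃ v, g (Nat.pair a (k + m)) l = some (v + 1) := by
  unfold rfindApprox at h
  simp only [Nat.unpair_pair] at h
  split_ifs at h with h0
  refine ⟨_, h0.1, (Option.some.inj h).symm, h0.2, fun k hk => ?_⟩
  have h2 := List.not_of_lt_findIdx hk
  simp only [List.getElem_range, decide_eq_false_iff_not] at h2
  cases hv : g (Nat.pair a (k + m)) l with
  | none => simp [hv] at h2
  | some v =>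
    simp only [hv, Option.getD_some] at h2
    exact ⟨v - 1, by congr 1; omega⟩

theorem rfindApprox_of {g : ℕ → List ℕ → Option ℕ} {a m i : ℕ} {l : List ℕ} (hi : i < l.length)
    (h0 : g (Nat.pair a (i + m)) l = some 0)
    (h : ∀ k < i, ∃ v, g (Nat.pair a (k + m)) l = some (v + 1)) :
    rfindApprox g (Nat.pair a m) l = some (i + m) := by
  unfold rfindApprox
  simp only [Nat.unpair_pair]
  have : ((List.range l.length).findIdx fun k =>
    decide ((g (Nat.pair a (k + m)) l).getD 0 = 0)) = i := by
    rw [List.findIdx_eq (by simpa using hi)]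
    refine ⟨by simp [h0], fun k hk => ?_⟩
    obtain ⟨v, hv⟩ := h k hk
    simp [hv]
  simp [this, h0, hi]

theorem Approx.rfind' {c : OracleCode} {g : ℕ → List ℕ → Option ℕ} (hg : Approx c g) :
    Approx (rfind' c) (rfindApprox g) where
  primrec := by
    have h1 : Primrec fun p : ℕ × List ℕ => p.1.unpair.1 :=
      Primrec.fst.comp (Primrec.unpair.comp Primrec.fst)
    have h2 : Primrec fun p : ℕ × List ℕ => p.1.unpair.2 :=
      Primrec.snd.comp (Primrec.unpair.comp Primrec.fst)
    have hG : Primrec₂ fun (p : ℕ × List ℕ) (k : ℕ) =>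
        g (Nat.pair p.1.unpair.1 (k + p.1.unpair.2)) p.2 :=
      hg.primrec.comp (Primrec₂.natPair.comp (h1.comp Primrec.fst)
        (Primrec.nat_add.comp Primrec.snd (h2.comp Primrec.fst))) (Primrec.snd.comp Primrec.fst)
    have hi : Primrec fun p : ℕ × List ℕ => (List.range p.2.length).findIdx fun k =>
        decide ((g (Nat.pair p.1.unpair.1 (k + p.1.unpair.2)) p.2).getD 0 = 0) := by
      refine Primrec.list_findIdx (Primrec.list_range.comp
        (Primrec.list_length.comp Primrec.snd)) ?_
      exact PrimrecPred.decide (Primrec.eq.comp (Primrec.option_getD.comp hG (Primrec.const 0))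
        (Primrec.const 0))
    refine Primrec.ite (c := fun p : ℕ × List ℕ => _ ∧ _) ?_ ?_ (Primrec.const none)
    · exact (Primrec.nat_lt.comp hi (Primrec.list_length.comp Primrec.snd)).and
        (Primrec.eq.comp (hG.comp Primrec.id hi) (Primrec.const (some 0)))
    · exact Primrec.option_some.comp (Primrec.nat_add.comp hi h2)
  mono := by
    intro n l l' y hl
    rw [← Nat.pair_unpair n]
    intro h
    obtain ⟨i, hi, rfl, h0, h⟩ := rfindApprox_eq_some h
    refine rfindApprox_of (hi.trans_le hl.length_le) (hg.mono hl h0) fun k hk => ?_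
    obtain ⟨v, hv⟩ := h k hk
    exact ⟨v, hg.mono hl hv⟩
  sound := by
    intro O n s y
    rw [← Nat.pair_unpair n]
    intro h
    obtain ⟨i, hi, rfl, h0, h⟩ := rfindApprox_eq_some h
    rw [eval_rfind']
    refine Part.mem_map _ (Nat.mem_rfind.2 ⟨?_, fun {k} hk => ?_⟩)
    · exact (Part.mem_map_iff _).2 ⟨0, hg.sound h0, rfl⟩
    · obtain ⟨v, hv⟩ := h k hk
      exact (Part.mem_map_iff _).2 ⟨v + 1, hg.sound hv, rfl⟩
  complete := by
    intro O n y
    rw [← Nat.pair_unpair n, eval_rfind', Part.mem_map_iff]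
    rintro ⟨i, hi, rfl⟩
    obtain ⟨h0, h⟩ := Nat.mem_rfind.1 hi
    obtain ⟨z, hz, hz0⟩ := (Part.mem_map_iff _).1 h0
    obtain rfl : z = 0 := by simpa using hz0
    obtain ⟨s, hs⟩ := hg.complete hz
    have key : ∀ k : ℕ, ∃ t, k < i → ∃ v,
        g (Nat.pair n.unpair.1 (k + n.unpair.2)) (res O t) = some (v + 1) := by
      intro k
      by_cases hk : k < i
      · obtain ⟨w, hw, hw0⟩ := (Part.mem_map_iff _).1 (h hk)
        obtain ⟨t, ht⟩ := hg.complete hw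
        refine ⟨t, fun _ => ⟨w - 1, ?_⟩⟩
        have : w ≠ 0 := by simpa using hw0
        rw [ht, Nat.sub_add_cancel (by omega)]
      · exact ⟨0, fun h => absurd h hk⟩
    choose t ht using key
    let T := max (max s (i + 1)) ((Finset.range i).sup t)
    have hiT : i + 1 ≤ T := (le_max_right s (i + 1)).trans (le_max_left _ _)
    refine ⟨T, rfindApprox_of (by rw [length_res]; omega) ?_ fun k hk => ?_⟩
    · exact hg.mono (res_prefix O ((le_max_left s (i + 1)).trans (le_max_left _ _))) hs
    · obtain ⟨v, hv⟩ := ht k hk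
      refine ⟨v, hg.mono (res_prefix O (le_trans ?_ (le_max_right _ _))) hv⟩
      exact Finset.le_sup (f := t) (Finset.mem_range.2 hk)

theorem exists_approx (c : OracleCode) : ∃ g, Approx c g := by
  induction c with
  | zero => exact ⟨_, Approx.of_total (Primrec.const 0) fun O n => eval_zero O n⟩
  | succ => exact ⟨_, Approx.of_total Primrec.succ fun O n => eval_succ O n⟩
  | left => exact ⟨_, Approx.of_total (Primrec.fst.comp Primrec.unpair) eval_left⟩
  | right => exact ⟨_, Approx.of_total (Primrec.snd.comp Primrec.unpair) eval_right⟩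
  | oracle => exact ⟨_, approx_oracle⟩
  | pair _ _ h1 h2 =>
    obtain ⟨_, h1⟩ := h1
    obtain ⟨_, h2⟩ := h2
    exact ⟨_, h1.pair h2⟩
  | comp _ _ h1 h2 =>
    obtain ⟨_, h1⟩ := h1
    obtain ⟨_, h2⟩ := h2
    exact ⟨_, h1.comp h2⟩
  | prec _ _ h1 h2 =>
    obtain ⟨_, h1⟩ := h1
    obtain ⟨_, h2⟩ := h2
    exact ⟨_, h1.prec h2⟩
  | rfind' _ h1 =>
    obtain ⟨_, h1⟩ := h1
    exact ⟨_, h1.rfind'⟩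

end OracleCode

open OracleCode

/-- `P` is recursively enumerable in the oracle `O`: it is witnessed by a monotone primitive
recursive relation on finite parts of the oracle. -/
def Sig (O : ℕ → ℕ) {α : Type} [Primcodable α] (P : α → Prop) : Prop :=
  ∃ R : α → List ℕ → Prop, PrimrecRel R ∧ (∀ a l l', l <+: l' → R a l → R a l') ∧
    ∀ a, P a ↔ ∃ s, R a (res O s)

namespace Sig

variable {O : ℕ → ℕ} {α β : Type} [Primcodable α] [Primcodable β]

theorem of_rel {P : α → Prop} {R : α → List ℕ → Prop} (hR : PrimrecRel R)
    (hP : ∀ a, P a ↔ ∃ s, R a (res O s)) : Sig O P := by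
  refine ⟨fun a l => ∃ t < l.length + 1, R a (l.take t), ?_, ?_, fun a => ?_⟩
  · have h : PrimrecRel fun (t : ℕ) (p : α × List ℕ) => R p.1 (p.2.take t) :=
      hR.comp (Primrec.fst.comp Primrec.snd)
        (Primrec.list_take.comp Primrec.fst (Primrec.snd.comp Primrec.snd))
    refine PrimrecPred.of_eq (h.exists_mem_list.comp (Primrec.list_range.comp (Primrec.succ.comp
      (Primrec.list_length.comp Primrec.snd))) Primrec.id) fun p => ?_
    simp
  · rintro a l _ ⟨r, rfl⟩ ⟨t, ht, h⟩
    refine ⟨t, ht.trans_le (by simp), ?_⟩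
    rwa [List.take_append_of_le_length (by omega)]
  · rw [hP]
    constructor
    · rintro ⟨s, hs⟩
      exact ⟨s, s, by simp, by rwa [take_res O le_rfl]⟩
    · rintro ⟨s, t, ht, h⟩
      rw [length_res] at ht
      exact ⟨t, by rwa [take_res O (by omega)] at h⟩

theorem of_primrec {P : α → Prop} (hP : PrimrecPred P) : Sig O P :=
  of_rel (R := fun a _ => P a) (hP.comp Primrec.fst) fun _ => by simp

theorem of_eq {P Q : α → Prop} (hP : Sig O P) (h : ∀ a, P a ↔ Q a) : Sig O Q := by
  obtain rfl : P = Q := funext fun a => propext (h a)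
  exact hP

theorem comp {P : α → Prop} (hP : Sig O P) {f : β → α} (hf : Primrec f) :
    Sig O fun b => P (f b) := by
  obtain ⟨R, h1, h2, h3⟩ := hP
  exact ⟨fun b l => R (f b) l, h1.comp (hf.comp Primrec.fst) Primrec.snd,
    fun b => h2 (f b), fun b => h3 (f b)⟩

theorem and {P Q : α → Prop} (hP : Sig O P) (hQ : Sig O Q) : Sig O fun a => P a ∧ Q a := by
  obtain ⟨R, h1, h2, h3⟩ := hP
  obtain ⟨S, k1, k2, k3⟩ := hQ
  refine ⟨fun a l => R a l ∧ S a l, PrimrecPred.and h1 k1,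
    fun a l l' hl h => ⟨h2 a l l' hl h.1, k2 a l l' hl h.2⟩, fun a => ?_⟩
  simp only [h3, k3]
  constructor
  · rintro ⟨⟨s, hs⟩, t, ht⟩
    exact ⟨max s t, h2 _ _ _ (res_prefix O (le_max_left s t)) hs,
      k2 _ _ _ (res_prefix O (le_max_right s t)) ht⟩
  · rintro ⟨s, hs, ht⟩
    exact ⟨⟨s, hs⟩, s, ht⟩

theorem or {P Q : α → Prop} (hP : Sig O P) (hQ : Sig O Q) : Sig O fun a => P a ∨ Q a := by
  obtain ⟨R, h1, h2, h3⟩ := hP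
  obtain ⟨S, k1, k2, k3⟩ := hQ
  refine ⟨fun a l => R a l ∨ S a l, PrimrecPred.or h1 k1,
    fun a l l' hl h => h.imp (h2 a l l' hl) (k2 a l l' hl), fun a => ?_⟩
  simp only [h3, k3, exists_or]

theorem ex {P : α → β → Prop} (hP : Sig O fun p : α × β => P p.1 p.2) :
    Sig O fun a => ∃ b, P a b := by
  obtain ⟨R, h1, h2, h3⟩ := hP
  refine of_rel (R := fun a l => ∃ b ∈ (Encodable.decode l.length.unpair.1 : Option β).toList,
    R (a, b) (l.take l.length.unpair.2)) ?_ fun a => ?_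
  · have h : PrimrecRel fun (b : β) (p : α × List ℕ) =>
        R (p.1, b) (p.2.take p.2.length.unpair.2) :=
      h1.comp (Primrec.pair (Primrec.fst.comp Primrec.snd) Primrec.fst)
        (Primrec.list_take.comp (Primrec.snd.comp (Primrec.unpair.comp (Primrec.list_length.comp
          (Primrec.snd.comp Primrec.snd)))) (Primrec.snd.comp Primrec.snd))
    exact h.exists_mem_list.comp (Primrec.optionToList.comp (Primrec.decode.comp
      (Primrec.fst.comp (Primrec.unpair.comp (Primrec.list_length.comp Primrec.snd))))) Primrec.id
  · constructor
    · rintro ⟨b, hb⟩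
      obtain ⟨s, hs⟩ := (h3 (a, b)).1 hb
      refine ⟨Nat.pair (Encodable.encode b) s, b, by simp, ?_⟩
      simpa [take_res O (Nat.right_le_pair _ _)] using hs
    · rintro ⟨s, b, -, h⟩
      rw [length_res, take_res O (Nat.unpair_right_le s)] at h
      exact ⟨b, (h3 (a, b)).2 ⟨_, h⟩⟩

theorem forall_mem {P : α → β → Prop} (hP : Sig O fun p : α × β => P p.1 p.2) :
    Sig O fun p : α × List β => ∀ b ∈ p.2, P p.1 b := by
  obtain ⟨R, h1, h2, h3⟩ := hP
  refine ⟨fun p l => ∀ b ∈ p.2, R (p.1, b) l, ?_,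
    fun a l l' hl h b hb => h2 _ _ _ hl (h b hb), fun p => ?_⟩
  · have h : PrimrecRel fun (b : β) (p : (α × List β) × List ℕ) => R (p.1.1, b) p.2 :=
      h1.comp (Primrec.pair (Primrec.fst.comp (Primrec.fst.comp Primrec.snd)) Primrec.fst)
        (Primrec.snd.comp Primrec.snd)
    exact h.forall_mem_list.comp (Primrec.snd.comp Primrec.fst) Primrec.id
  · obtain ⟨a, L⟩ := p
    simp only
    constructor
    · intro h
      induction L with
      | nil => exact ⟨0, by simp⟩
      | cons b L ih =>
        obtain ⟨s, hs⟩ := ih fun b hb => h b (List.mem_cons_of_mem _ hb)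
        obtain ⟨t, ht⟩ := (h3 (a, b)).1 (h b List.mem_cons_self)
        refine ⟨max s t, fun c hc => ?_⟩
        rcases List.mem_cons.1 hc with rfl | hc
        · exact h2 _ _ _ (res_prefix O (le_max_right s t)) ht
        · exact h2 _ _ _ (res_prefix O (le_max_left s t)) (hs c hc)
    · rintro ⟨s, hs⟩ b hb
      exact (h3 (a, b)).2 ⟨s, hs b hb⟩

theorem mem_eval (c : OracleCode) : Sig O fun p : ℕ × ℕ => p.2 ∈ eval O c p.1 := by
  obtain ⟨g, hg⟩ := exists_approx c
  refine of_rel (R := fun p l => g p.1 l = some p.2) ?_ fun p => ⟨hg.complete, fun ⟨s, hs⟩ =>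
    hg.sound hs⟩
  exact Primrec.eq.comp (hg.primrec.comp (Primrec.fst.comp Primrec.fst) Primrec.snd)
    (Primrec.option_some.comp (Primrec.snd.comp Primrec.fst))

theorem mem_evalStr (c : OracleCode) :
    Sig O fun p : List Bool × List Bool => p.2 ∈ evalStr c O p.1 := by
  have h : Sig O fun q : (List Bool × List Bool) × ℕ =>
      q.2 ∈ eval O c (Encodable.encode q.1.1) ∧
        (Encodable.decode q.2 : Option (List Bool)) = some q.1.2 := by
    refine and ((mem_eval c).comp (Primrec.pair (Primrec.encode.comp (Primrec.fst.comp Primrec.fst))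
      Primrec.snd)) (of_primrec ?_)
    exact Primrec.eq.comp (Primrec.decode.comp Primrec.snd)
      (Primrec.option_some.comp (Primrec.snd.comp Primrec.fst))
  refine (Sig.ex (P := fun (p : List Bool × List Bool) m =>
    m ∈ eval O c (Encodable.encode p.1) ∧
      (Encodable.decode m : Option (List Bool)) = some p.2) h).of_eq fun p => ?_
  simp [evalStr, Part.mem_bind_iff]

end Sig

theorem ceSeqIn_iff {A : Set ℕ} {W : ℕ → Set (List Bool)} :
    CeSeqIn A W ↔ Sig (chi A) fun p : ℕ × List Bool => p.2 ∈ W p.1 := by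
  constructor
  · rintro ⟨c, hc⟩
    have h := (Sig.mem_eval (O := chi A) c).comp
      (f := fun q : (ℕ × List Bool) × ℕ => (Encodable.encode q.1, q.2))
      (Primrec.pair (Primrec.encode.comp Primrec.fst) Primrec.snd)
    refine (Sig.ex (P := fun (p : ℕ × List Bool) m => m ∈ eval (chi A) c (Encodable.encode p))
      h).of_eq fun p => ?_
    rw [hc, Part.dom_iff_mem]
    rfl
  · rintro ⟨R, h1, h2, h3⟩
    classical
    have hg : Primrec₂ fun (m : ℕ) (l : List ℕ) =>
        (Encodable.decode m : Option (ℕ × List Bool)).bind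
          fun p => if R p l then some 0 else none := by
      refine Primrec.option_bind (Primrec.decode.comp Primrec.fst) ?_
      refine Primrec.ite (c := fun q : (ℕ × List ℕ) × (ℕ × List Bool) => R q.2 q.1.2) ?_
        (Primrec.const (some 0)) (Primrec.const none)
      exact PrimrecRel.comp h1 Primrec.snd (Primrec.snd.comp Primrec.fst)
    obtain ⟨c, hc⟩ := exists_code_search hg
    refine ⟨c, fun n σ => ?_⟩
    have hd : (Encodable.decode (Nat.pair n (Encodable.encode σ)) : Option (ℕ × List Bool)) =
        some (n, σ) := by simp
    refine (h3 (n, σ)).trans ?_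
    obtain ⟨c1, c2⟩ := hc (chi A) (Nat.pair n (Encodable.encode σ))
    constructor
    · rintro ⟨s, hs⟩
      refine c2 s ?_
      simp [hd, hs]
    · intro h
      obtain ⟨y, hy⟩ := Part.dom_iff_mem.1 h
      obtain ⟨s, hs⟩ := c1 y hy
      refine ⟨s, ?_⟩
      by_contra hn
      simp [hd, hn] at hs

open scoped ENNReal

/-- The natural number with binary expansion `σ`. -/
def val (σ : List Bool) : ℕ := σ.foldl (fun v b => 2 * v + b.toNat) 0

@[simp] theorem val_nil : val [] = 0 := rfl

@[simp] theorem val_concat (σ : List Bool) (b : Bool) : val (σ ++ [b]) = 2 * val σ + b.toNat := by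
  simp [val]

theorem val_append (σ τ : List Bool) : val (σ ++ τ) = val σ * 2 ^ τ.length + val τ := by
  induction τ using List.reverseRecOn with
  | nil => simp
  | append_singleton τ b ih =>
    rw [← List.append_assoc, val_concat, ih, val_concat, List.length_append, pow_add]
    simp
    ring

theorem val_lt (σ : List Bool) : val σ < 2 ^ σ.length := by
  induction σ using List.reverseRecOn with
  | nil => simp
  | append_singleton σ b ih =>
    rw [val_concat, List.length_append, pow_add]
    have := b.toNat_le
    simp
    omega

theorem exists_val (n v : ℕ) (hv : v < 2 ^ n) : ∃ σ : List Bool, σ.length = n ∧ val σ = v := by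
  induction n generalizing v with
  | zero => exact ⟨[], rfl, by simp at hv; simp [hv]⟩
  | succ n ih =>
    obtain ⟨σ, h1, h2⟩ := ih (v / 2) (by rw [pow_succ] at hv; omega)
    refine ⟨σ ++ [decide (v % 2 = 1)], by simp [h1], ?_⟩
    rw [val_concat, h2]
    rcases Nat.mod_two_eq_zero_or_one v with h | h <;> simp [h] <;> omega

/-- The cylinder of sequences extending `σ`. -/
def cyl (σ : List Bool) : Set (ℕ → Bool) := {X | res X σ.length = σ}

theorem mem_cyl_res (X : ℕ → Bool) (n : ℕ) : X ∈ cyl (res X n) := by simp [cyl]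

theorem mem_cyl_iff {X : ℕ → Bool} {σ : List Bool} {n : ℕ} (h : σ.length ≤ n) :
    X ∈ cyl σ ↔ σ <+: res X n := by
  constructor
  · intro hX
    rw [cyl, Set.mem_ofPred_eq] at hX
    rw [← hX]
    exact res_prefix X h
  · intro hX
    exact (eq_res_of_prefix hX).symm

theorem mem_cyl_iff_forall {X : ℕ → Bool} {σ : List Bool} :
    X ∈ cyl σ ↔ ∀ i : Fin σ.length, X i = σ.get i := by
  rw [cyl, Set.mem_ofPred_eq, List.ext_get_iff]
  simp [res, Fin.forall_iff]

theorem Cyl_eq_iUnion (W : Set (List Bool)) : Cyl W = ⋃ σ : W, cyl σ := by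
  ext X
  simp [Cyl, mem_cyl_iff_forall]

theorem mem_Cyl {W : Set (List Bool)} {X : ℕ → Bool} : X ∈ Cyl W ↔ ∃ n, res X n ∈ W := by
  rw [Cyl_eq_iUnion, Set.mem_iUnion]
  constructor
  · rintro ⟨⟨σ, h⟩, hX⟩
    exact ⟨σ.length, by rwa [show res X σ.length = σ from hX]⟩
  · rintro ⟨n, hn⟩
    exact ⟨⟨_, hn⟩, mem_cyl_res X n⟩

theorem cyl_subset_Cyl {W : Set (List Bool)} {σ : List Bool} (h : σ ∈ W) : cyl σ ⊆ Cyl W := by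
  rw [Cyl_eq_iUnion]
  exact Set.subset_iUnion (fun σ : W => cyl σ) ⟨σ, h⟩

@[simp] theorem cyl_nil : cyl [] = Set.univ := by simp [cyl]

theorem cyl_antitone {σ τ : List Bool} (h : σ <+: τ) : cyl τ ⊆ cyl σ := by
  intro X hX
  rw [mem_cyl_iff h.length_le, show res X τ.length = τ from hX]
  exact h

theorem prefix_or_prefix_of_mem_cyl {X : ℕ → Bool} {σ τ : List Bool} (hσ : X ∈ cyl σ)
    (hτ : X ∈ cyl τ) : σ <+: τ ∨ τ <+: σ := by
  rw [mem_cyl_iff (le_max_left _ τ.length)] at hσ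
  rw [mem_cyl_iff (le_max_right σ.length _)] at hτ
  exact List.prefix_or_prefix_of_prefix hσ hτ

theorem measurableSet_res (L : Set (List Bool)) (n : ℕ) : MeasurableSet {X | res X n ∈ L} := by
  have h : Measurable fun X : ℕ → Bool => fun i : Fin n => X i := by fun_prop
  have : {X | res X n ∈ L} = (fun X : ℕ → Bool => fun i : Fin n => X i) ⁻¹'
      {f | List.ofFn f ∈ L} := by
    ext X
    simp [res, List.ofFn_eq_map, ← List.map_coe_finRange_eq_range, Function.comp_def]
  rw [this]
  exact h (Set.toFinite _).measurableSet

theorem measurableSet_cyl (σ : List Bool) : MeasurableSet (cyl σ) :=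
  measurableSet_res {σ} σ.length

theorem measurableSet_Cyl (W : Set (List Bool)) : MeasurableSet (Cyl W) := by
  rw [Cyl_eq_iUnion]
  exact MeasurableSet.iUnion fun σ => measurableSet_cyl σ

theorem measurable_binary :
    Measurable fun (x : ℝ) (n : ℕ) => decide (⌊x * 2 ^ (n + 1)⌋₊ % 2 = 1) := by
  refine measurable_pi_lambda _ fun n => ?_
  have h : Measurable fun x : ℝ => ⌊x * 2 ^ (n + 1)⌋₊ :=
    Nat.measurable_floor.comp (measurable_id.mul_const _)
  exact (measurable_from_top (f := fun k : ℕ => decide (k % 2 = 1))).comp h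

theorem binary_mem_cyl_iff {x : ℝ} (h1 : x < 1) (σ : List Bool) :
    (fun n : ℕ => decide (⌊x * 2 ^ (n + 1)⌋₊ % 2 = 1)) ∈ cyl σ ↔
      ⌊x * 2 ^ σ.length⌋₊ = val σ := by
  induction σ using List.reverseRecOn with
  | nil => simp [Nat.floor_eq_zero, h1]
  | append_singleton σ b ih =>
    simp only [cyl, Set.mem_ofPred_eq] at ih
    simp only [cyl, Set.mem_ofPred_eq, List.length_append, List.length_singleton, res_succ,
      val_concat]
    have h2 : ⌊x * 2 ^ (σ.length + 1)⌋₊ / 2 = ⌊x * 2 ^ σ.length⌋₊ := by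
      rw [← Nat.floor_div_ofNat, pow_succ, ← mul_assoc, mul_div_assoc]
      simp
    rw [← h2] at ih
    rw [← List.concat_eq_append, ← List.concat_eq_append, List.concat_inj, ih]
    generalize ⌊x * 2 ^ (σ.length + 1)⌋₊ = N
    cases b <;> simp <;> omega

theorem mu_cyl (σ : List Bool) : mu (cyl σ) = 2⁻¹ ^ σ.length := by
  rw [mu, Measure.map_apply measurable_binary (measurableSet_cyl σ),
    Measure.restrict_apply (measurable_binary (measurableSet_cyl σ))]
  have h2 : (0 : ℝ) < 2 ^ σ.length := by positivity
  have : (fun (x : ℝ) (n : ℕ) => decide (⌊x * 2 ^ (n + 1)⌋₊ % 2 = 1)) ⁻¹' cyl σ ∩ Set.Ico 0 1 =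
      Set.Ico ((val σ : ℝ) / 2 ^ σ.length) ((val σ + 1) / 2 ^ σ.length) := by
    ext x
    have hv : ((val σ : ℝ) + 1) ≤ 2 ^ σ.length := by exact_mod_cast val_lt σ
    simp only [Set.mem_inter_iff, Set.mem_preimage, Set.mem_Ico]
    rw [div_le_iff₀ h2, lt_div_iff₀ h2]
    constructor
    · rintro ⟨h, h0, h1⟩
      rw [binary_mem_cyl_iff h1] at h
      exact (Nat.floor_eq_iff (by positivity)).1 h
    · rintro ⟨h3, h4⟩
      have h0 : 0 ≤ x := by
        by_contra! h
        have := mul_neg_of_neg_of_pos h h2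
        have : (0 : ℝ) ≤ val σ := by positivity
        linarith
      have h1 : x < 1 := by
        by_contra! h
        have := mul_le_mul_of_nonneg_right h h2.le
        linarith
      exact ⟨(binary_mem_cyl_iff h1 σ).2 ((Nat.floor_eq_iff (by positivity)).2 ⟨h3, h4⟩), h0, h1⟩
  rw [this, Real.volume_Ico, add_div, add_sub_cancel_left, ENNReal.ofReal_div_of_pos h2,
    ENNReal.ofReal_pow (by norm_num), ENNReal.div_eq_inv_mul, ENNReal.inv_pow]
  simp

instance : IsProbabilityMeasure mu := ⟨by simpa using mu_cyl []⟩

/-- The total weight of a set of strings. -/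
noncomputable def wt (W : Set (List Bool)) : ℝ≥0∞ := ∑' σ : W, 2⁻¹ ^ (σ : List Bool).length

theorem mu_Cyl_le (W : Set (List Bool)) : mu (Cyl W) ≤ wt W := by
  rw [Cyl_eq_iUnion]
  refine (measure_iUnion_le _).trans (le_of_eq ?_)
  simp [wt, mu_cyl]

/-- A set of pairwise prefix-incomparable strings. -/
def PrefixFree (W : Set (List Bool)) : Prop := ∀ σ ∈ W, ∀ τ ∈ W, σ <+: τ → σ = τ

theorem PrefixFree.mu_Cyl {W : Set (List Bool)} (hW : PrefixFree W) : mu (Cyl W) = wt W := by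
  rw [Cyl_eq_iUnion, measure_iUnion _ fun σ : W => measurableSet_cyl σ]
  · simp [wt, mu_cyl]
  · rintro ⟨σ, hσ⟩ ⟨τ, hτ⟩ hne
    refine Set.disjoint_left.2 fun X h1 h2 => hne ?_
    rcases prefix_or_prefix_of_mem_cyl h1 h2 with h | h
    · exact Subtype.ext (hW _ hσ _ hτ h)
    · exact Subtype.ext (hW _ hτ _ hσ h).symm

theorem PrefixFree.wt_le_one {W : Set (List Bool)} (hW : PrefixFree W) : wt W ≤ 1 :=
  hW.mu_Cyl ▸ prob_le_one

theorem prefixFree_of_length {W : Set (List Bool)} {n : ℕ} (h : ∀ σ ∈ W, σ.length = n) :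
    PrefixFree W := fun _ hσ _ hτ hp => hp.eq_of_length ((h _ hσ).trans (h _ hτ).symm)

/-- A coordinate is independent of the earlier ones. -/
theorem mu_res_and_coord (L : Set (List Bool)) (n : ℕ) (b : Bool) :
    mu {X | res X n ∈ L ∧ X n = b} = 2⁻¹ * mu {X | res X n ∈ L} := by
  let D : Set (List Bool) := {σ | σ ∈ L ∧ σ.length = n}
  let e : D → List Bool := fun σ => σ ++ [b]
  have he : Function.Injective e := fun σ τ h => Subtype.ext (List.append_cancel_right h)
  have h1 : {X | res X n ∈ L} = Cyl D := by
    ext X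
    simp [mem_Cyl, D]
  have h2 : {X | res X n ∈ L ∧ X n = b} = Cyl (Set.range e) := by
    ext X
    simp only [mem_Cyl, Set.mem_ofPred_eq, Set.mem_range, Subtype.exists, e, D]
    constructor
    · rintro ⟨h, rfl⟩
      exact ⟨n + 1, res X n, ⟨h, by simp⟩, (res_succ X n).symm⟩
    · rintro ⟨m, σ, ⟨h, rfl⟩, hm⟩
      obtain rfl : m = σ.length + 1 := by simpa using (congrArg List.length hm).symm
      rw [res_succ] at hm
      obtain ⟨h3, h4⟩ := List.append_inj' hm rfl
      refine ⟨h3 ▸ h, by simpa using h4.symm⟩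
  have h3 : PrefixFree D := prefixFree_of_length fun σ h => h.2
  have h4 : PrefixFree (Set.range e) :=
    prefixFree_of_length (n := n + 1) (by rintro _ ⟨σ, rfl⟩; simp [e, σ.2.2])
  rw [h1, h2, h3.mu_Cyl, h4.mu_Cyl, wt, wt, ← ENNReal.tsum_mul_left]
  refine (tsum_range (fun σ : List Bool => (2⁻¹ : ℝ≥0∞) ^ σ.length) he).trans
    (tsum_congr fun σ => ?_)
  simp [e, pow_succ']

theorem mu_forall_false (T : Finset ℕ) : mu {X | ∀ j ∈ T, X j = false} = 2⁻¹ ^ T.card := by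
  induction T using Finset.induction_on_max with
  | empty => simp
  | insert n T hn ih =>
    have h1 : {X : ℕ → Bool | ∀ j ∈ T, X j = false} =
        {X | res X n ∈ {σ : List Bool | ∀ j ∈ T, σ[j]? = some false}} := by
      ext X
      simp only [Set.mem_ofPred_eq]
      exact forall₂_congr fun j hj => by simp [getElem?_res X (hn j hj)]
    have h2 := mu_res_and_coord {σ : List Bool | ∀ j ∈ T, σ[j]? = some false} n false
    rw [← h1, ih] at h2
    rw [Finset.card_insert_of_notMem fun h => (hn n h).false, pow_succ', ← h2]
    congr 1
    ext X
    have := Set.ext_iff.1 h1 X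
    simp only [Set.mem_ofPred_eq] at this
    simp only [Set.mem_ofPred_eq, Finset.mem_insert, forall_eq_or_imp, this]
    exact and_comm

/-- Disjoint blocks of coordinates are independent. -/
theorem mu_blocks {ι : Type*} (C : ι → Finset ℕ)
    (F : Finset ι) (T : Finset ℕ) (hT : ∀ i ∈ F, Disjoint T (C i))
    (hC : (F : Set ι).PairwiseDisjoint C) :
    mu.real {X | (∀ j ∈ T, X j = false) ∧ ∀ i ∈ F, ¬∀ j ∈ C i, X j = false} =
      2⁻¹ ^ T.card * ∏ i ∈ F, (1 - 2⁻¹ ^ (C i).card) := by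
  classical
  induction F using Finset.induction_on generalizing T with
  | empty => simp [measureReal_def, mu_forall_false]
  | insert i F hi ih =>
    simp only [Finset.coe_insert, Set.pairwiseDisjoint_insert, Finset.mem_insert,
      forall_eq_or_imp] at hC hT ⊢
    have h1 := ih T hT.2 hC.1
    have h2 := ih (T ∪ C i) (fun k hk => Finset.disjoint_union_left.2
      ⟨hT.2 k hk, hC.2 k hk fun h => hi (h ▸ hk)⟩) hC.1
    have hm : MeasurableSet {X : ℕ → Bool | ∀ j ∈ C i, X j = false} := by
      have : {X : ℕ → Bool | ∀ j ∈ C i, X j = false} = ⋂ j ∈ C i, {X | X j = false} := by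
        ext; simp
      rw [this]
      exact Finset.measurableSet_biInter _ fun j _ =>
          measurable_pi_apply j (measurableSet_singleton _)
    have h3 := measureReal_inter_add_sdiff (μ := mu)
      (s := {X : ℕ → Bool | (∀ j ∈ T, X j = false) ∧ ∀ i ∈ F, ¬∀ j ∈ C i, X j = false}) hm
    rw [Finset.prod_insert hi]
    have h4 : {X : ℕ → Bool | (∀ j ∈ T, X j = false) ∧ ∀ i ∈ F, ¬∀ j ∈ C i, X j = false} ∩
        {X | ∀ j ∈ C i, X j = false} =
        {X | (∀ j ∈ T ∪ C i, X j = false) ∧ ∀ i ∈ F, ¬∀ j ∈ C i, X j = false} := by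
      ext X
      simp only [Set.mem_inter_iff, Set.mem_ofPred_eq, Finset.mem_union, or_imp, forall_and]
      tauto
    have h5 : {X : ℕ → Bool | (∀ j ∈ T, X j = false) ∧ ∀ i ∈ F, ¬∀ j ∈ C i, X j = false} \
        {X | ∀ j ∈ C i, X j = false} = {X | (∀ j ∈ T, X j = false) ∧
          (¬∀ j ∈ C i, X j = false) ∧ ∀ i ∈ F, ¬∀ j ∈ C i, X j = false} := by
      ext X
      simp only [Set.mem_sdiff, Set.mem_ofPred_eq]
      tauto
    rw [h4, h5, h1, h2, Finset.card_union_of_disjoint hT.1, pow_add] at h3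
    linarith

/-- The numerator, over the denominator `2 ^ s`, of the total length of the intervals allocated
to the requests made before stage `s`. -/
def alloc (a : ℕ → Option (ℕ × List Bool)) : ℕ → ℕ
  | 0 => 0
  | s + 1 => 2 * alloc a s + (a s).elim 0 fun p => 2 ^ (s + 1 - p.1)

theorem alloc_congr {a b : ℕ → Option (ℕ × List Bool)} {s : ℕ} (h : ∀ t < s, a t = b t) :
    alloc a s = alloc b s := by
  induction s with
  | zero => rfl
  | succ s ih => rw [alloc, alloc, ih fun t ht => h t (by omega), h s (by omega)]

/-- The string `σ` describes the request made at stage `s`. -/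
def Fits (a : ℕ → Option (ℕ × List Bool)) (s : ℕ) (p : ℕ × List Bool) (σ : List Bool) : Prop :=
  a s = some p ∧ σ.length = p.1 + 1 ∧ alloc a s * 2 ^ σ.length ≤ val σ * 2 ^ s ∧
    (val σ + 1) * 2 ^ (s + 1) ≤ alloc a (s + 1) * 2 ^ σ.length

/-- The position reached by the allocation before stage `s`. -/
noncomputable def pos (a : ℕ → Option (ℕ × List Bool)) (s : ℕ) : ℝ := alloc a s / 2 ^ s

theorem pos_mono (a : ℕ → Option (ℕ × List Bool)) : Monotone (pos a) := by
  refine monotone_nat_of_le_succ fun s => ?_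
  rw [pos, pos, div_le_div_iff₀ (by positivity) (by positivity), pow_succ]
  have : ((2 * alloc a s : ℕ) : ℝ) ≤ alloc a (s + 1) := by
    exact_mod_cast Nat.le_add_right _ _
  push_cast at this
  have h : (0 : ℝ) < 2 ^ s := by positivity
  nlinarith

theorem pos_succ {a : ℕ → Option (ℕ × List Bool)} {s : ℕ} {p : ℕ × List Bool}
    (h : a s = some p) (hp : p.1 ≤ s) : pos a (s + 1) = pos a s + 2⁻¹ ^ p.1 := by
  obtain ⟨r, rfl⟩ := Nat.exists_eq_add_of_le hp
  rw [pos, pos, alloc, h]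
  simp only [Option.elim_some]
  rw [show p.1 + r + 1 - p.1 = r + 1 by omega]
  push_cast
  rw [inv_pow]
  field_simp
  ring

theorem pos_succ_none {a : ℕ → Option (ℕ × List Bool)} {s : ℕ} (h : a s = none) :
    pos a (s + 1) = pos a s := by
  rw [pos, pos, alloc, h]
  simp only [Option.elim_none, pow_succ]
  push_cast
  field_simp
  ring

theorem Fits.pos_le {a : ℕ → Option (ℕ × List Bool)} {s : ℕ} {p : ℕ × List Bool} {σ : List Bool}
    (h : Fits a s p σ) : pos a s ≤ (val σ : ℝ) / 2 ^ σ.length := by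
  rw [pos, div_le_div_iff₀ (by positivity) (by positivity)]
  exact_mod_cast h.2.2.1

theorem Fits.le_pos {a : ℕ → Option (ℕ × List Bool)} {s : ℕ} {p : ℕ × List Bool} {σ : List Bool}
    (h : Fits a s p σ) : ((val σ : ℝ) + 1) / 2 ^ σ.length ≤ pos a (s + 1) := by
  rw [pos, div_le_div_iff₀ (by positivity) (by positivity)]
  exact_mod_cast h.2.2.2

theorem val_div_le_of_prefix {σ τ : List Bool} (h : σ <+: τ) :
    (val σ : ℝ) / 2 ^ σ.length ≤ val τ / 2 ^ τ.length := by
  obtain ⟨ρ, rfl⟩ := h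
  rw [div_le_div_iff₀ (by positivity) (by positivity), val_append, List.length_append, pow_add]
  push_cast
  nlinarith [mul_nonneg (Nat.cast_nonneg (α := ℝ) (val ρ)) (pow_pos (two_pos (α := ℝ)) σ.length).le]

theorem val_div_lt_of_prefix {σ τ : List Bool} (h : σ <+: τ) :
    (val τ : ℝ) / 2 ^ τ.length < (val σ + 1) / 2 ^ σ.length := by
  obtain ⟨ρ, rfl⟩ := h
  rw [div_lt_div_iff₀ (by positivity) (by positivity), val_append, List.length_append, pow_add]
  have h1 : (val ρ : ℝ) < 2 ^ ρ.length := by exact_mod_cast val_lt ρ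
  have h2 : (0 : ℝ) < 2 ^ σ.length := by positivity
  push_cast
  nlinarith

theorem Fits.eq_of_prefix {a : ℕ → Option (ℕ × List Bool)} {s t : ℕ} {p q : ℕ × List Bool}
    {σ τ : List Bool} (h : Fits a s p σ) (h' : Fits a t q τ) (hp : σ <+: τ) : s = t := by
  rcases lt_trichotomy s t with hst | hst | hst
  · have h1 := val_div_lt_of_prefix hp
    have h2 := pos_mono a (Nat.succ_le_of_lt hst)
    linarith [h.le_pos, h'.pos_le, h1, h2]
  · exact hst
  · have h1 := val_div_le_of_prefix hp
    have h2 := pos_mono a (Nat.succ_le_of_lt hst)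
    have h3 : (val τ : ℝ) / 2 ^ τ.length < (val τ + 1) / 2 ^ τ.length := by gcongr; linarith
    linarith [h'.le_pos, h.pos_le, h1, h2]

theorem exists_fits {a : ℕ → Option (ℕ × List Bool)} {s : ℕ} {p : ℕ × List Bool}
    (h : a s = some p) (hp : p.1 ≤ s) (h1 : pos a (s + 1) ≤ 1) : ∃ σ, Fits a s p σ := by
  have h2 := pos_succ h hp
  let v := ⌈pos a s * 2 ^ (p.1 + 1)⌉₊
  have h0 : 0 ≤ pos a s := by unfold pos; positivity
  have h3 : pos a s * 2 ^ (p.1 + 1) ≤ v := Nat.le_ceil _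
  have h4 : (v : ℝ) < pos a s * 2 ^ (p.1 + 1) + 1 := Nat.ceil_lt_add_one (by positivity)
  have h5 : (v : ℝ) + 1 ≤ pos a (s + 1) * 2 ^ (p.1 + 1) := by
    have : (2⁻¹ : ℝ) ^ p.1 * 2 ^ (p.1 + 1) = 2 := by
      rw [pow_succ, ← mul_assoc, ← mul_pow]
      norm_num
    rw [h2, add_mul, this]
    linarith
  have h6 : v < 2 ^ (p.1 + 1) := by
    have h7 : (0 : ℝ) < 2 ^ (p.1 + 1) := by positivity
    have : (v : ℝ) < 2 ^ (p.1 + 1) := by nlinarith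
    exact_mod_cast this
  obtain ⟨σ, hl, hv⟩ := exists_val _ _ h6
  refine ⟨σ, h, hl, ?_, ?_⟩
  · rw [pos, div_mul_eq_mul_div, div_le_iff₀ (by positivity)] at h3
    rw [hl, hv]
    exact_mod_cast h3
  · rw [pos, div_mul_eq_mul_div, le_div_iff₀ (by positivity)] at h5
    rw [hl, hv]
    exact_mod_cast h5

theorem pos_eq_sum {a : ℕ → Option (ℕ × List Bool)} (ha : ∀ s p, a s = some p → p.1 ≤ s) (s : ℕ) :
    pos a s = ∑ t ∈ Finset.range s, (a t).elim 0 fun p => 2⁻¹ ^ p.1 := by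
  induction s with
  | zero => simp [pos, alloc]
  | succ s ih =>
    rw [Finset.sum_range_succ, ← ih]
    cases h : a s with
    | none => simp [pos_succ_none h]
    | some p => simp [pos_succ h (ha s p h)]

theorem pos_le_one {a : ℕ → Option (ℕ × List Bool)} (ha : ∀ s p, a s = some p → p.1 ≤ s)
    (hinj : ∀ s t p, a s = some p → a t = some p → s = t) {P : Set (ℕ × List Bool)}
    (hP : ∀ s p, a s = some p → p ∈ P) (hw : ∑' p : P, (2⁻¹ : ℝ≥0∞) ^ p.1.1 ≤ 1) (s : ℕ) :
    pos a s ≤ 1 := by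
  let f : {t // (a t).isSome} → P := fun t => ⟨(a t).get t.2, hP t _ (Option.some_get t.2).symm⟩
  have hf : Function.Injective f := by
    rintro ⟨t, ht⟩ ⟨t', ht'⟩ h
    refine Subtype.ext (hinj t t' ((a t).get ht) (Option.some_get ht).symm ?_)
    rw [show (a t).get ht = (a t').get ht' from congrArg Subtype.val h, Option.some_get]
  have h1 : ∑' t, ((a t).elim 0 fun p => 2⁻¹ ^ p.1 : ℝ≥0∞) ≤ 1 := by
    refine le_trans (le_of_eq ?_) ((ENNReal.tsum_comp_le_tsum_of_injective hf _).trans hw)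
    refine ((tsum_subtype_eq_of_support_subset (s := {t | (a t).isSome}) ?_).symm).trans
      (tsum_congr ?_)
    · intro t ht
      by_contra h
      simp at h
      simp [h] at ht
    · rintro ⟨t, ht⟩
      obtain ⟨p, hp⟩ := Option.isSome_iff_exists.1 ht
      simp [f, hp]
  have h2 := (ENNReal.sum_le_tsum (Finset.range s)).trans h1
  rw [pos_eq_sum ha, ← ENNReal.ofReal_le_one, ENNReal.ofReal_sum_of_nonneg]
  · refine le_trans (Finset.sum_le_sum fun t _ => ?_) h2
    cases a t with
    | none => simp
    | some p => simp [ENNReal.ofReal_pow, ENNReal.ofReal_inv_of_pos, ENNReal.inv_pow]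
  · intro t _
    cases a t <;> simp

theorem _root_.Primrec.nat_pow : Primrec₂ ((· ^ ·) : ℕ → ℕ → ℕ) :=
  Primrec₂.unpaired'.1 Nat.Primrec.pow

theorem primrec_val : Primrec val := by
  refine Primrec.list_foldl (h := fun _ (p : ℕ × Bool) => 2 * p.1 + p.2.toNat) Primrec.id
    (Primrec.const 0)
    (Primrec.nat_add.comp (Primrec.nat_mul.comp (Primrec.const 2)
      (Primrec.fst.comp Primrec.snd)) ?_)
  exact (Primrec.dom_finite Bool.toNat).comp (Primrec.snd.comp Primrec.snd)

theorem primrec_alloc {α : Type} [Primcodable α] {a : α → ℕ → Option (ℕ × List Bool)}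
    (ha : Primrec₂ a) : Primrec₂ fun x s => alloc (a x) s := by
  have h : Primrec₂ fun (x : α) (p : ℕ × ℕ) =>
      2 * p.2 + (a x p.1).elim 0 fun q => 2 ^ (p.1 + 1 - q.1) := by
    refine Primrec.nat_add.comp (Primrec.nat_mul.comp (Primrec.const 2)
      (Primrec.snd.comp Primrec.snd)) ?_
    refine (Primrec.option_casesOn (o := fun y : α × ℕ × ℕ => a y.1 y.2.1) (f := fun _ => 0)
      (g := fun y q => 2 ^ (y.2.1 + 1 - q.1))
      (ha.comp Primrec.fst (Primrec.fst.comp Primrec.snd)) (Primrec.const 0) ?_).of_eq fun y => ?_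
    · exact Primrec.nat_pow.comp (Primrec.const 2) (Primrec.nat_sub.comp (Primrec.succ.comp
        (Primrec.fst.comp (Primrec.snd.comp Primrec.fst))) (Primrec.fst.comp Primrec.snd))
    · cases a y.1 y.2.1 <;> rfl
  refine (Primrec.nat_rec (Primrec.const 0) h).of_eq fun x s => ?_
  induction s with
  | zero => rfl
  | succ s ih =>
    simp only at ih
    simp only [alloc, ← ih]

theorem primrec_fits {α : Type} [Primcodable α] {a : α → ℕ → Option (ℕ × List Bool)}
    (ha : Primrec₂ a) {s : α → ℕ} (hs : Primrec s) {p : α → ℕ × List Bool} (hp : Primrec p)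
    {σ : α → List Bool} (hσ : Primrec σ) :
    PrimrecPred fun x => Fits (a x) (s x) (p x) (σ x) := by
  have hl := Primrec.list_length.comp hσ
  have hpow : ∀ {f : α → ℕ}, Primrec f → Primrec fun x => 2 ^ f x := fun hf =>
    Primrec.nat_pow.comp (Primrec.const 2) hf
  refine (Primrec.eq.comp (ha.comp Primrec.id hs) (Primrec.option_some.comp hp)).and
    ((Primrec.eq.comp hl (Primrec.succ.comp (Primrec.fst.comp hp))).and
      ((Primrec.nat_le.comp ?_ ?_).and (Primrec.nat_le.comp ?_ ?_)))
  · exact Primrec.nat_mul.comp ((primrec_alloc ha).comp Primrec.id hs) (hpow hl)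
  · exact Primrec.nat_mul.comp (primrec_val.comp hσ) (hpow hs)
  · exact Primrec.nat_mul.comp (Primrec.succ.comp (primrec_val.comp hσ))
      (hpow (Primrec.succ.comp hs))
  · exact Primrec.nat_mul.comp ((primrec_alloc ha).comp Primrec.id (Primrec.succ.comp hs))
      (hpow hl)

/-- The Kraft–Chaitin theorem, relative to an oracle. -/
theorem kraft_chaitin {u : OracleCode} (hu : UniversalPFM u) {O : ℕ → ℕ}
    {P : Set (ℕ × List Bool)} (hP : Sig O (· ∈ P))
    (hw : ∑' p : P, (2⁻¹ : ℝ≥0∞) ^ p.1.1 ≤ 1) :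
    ∃ d, ∀ p ∈ P, ∃ σ, p.2 ∈ evalStr u O σ ∧ σ.length ≤ p.1 + d := by
  classical
  obtain ⟨R, h1, h2, h3⟩ := hP
  let act : List ℕ → Option (ℕ × List Bool) := fun l =>
    (Encodable.decode l.length.unpair.1 : Option (ℕ × List Bool)).bind fun p =>
      if Encodable.encode p = l.length.unpair.1 ∧ R p (l.take l.length.unpair.2) ∧
        ¬(0 < l.length.unpair.2 ∧ R p (l.take (l.length.unpair.2 - 1))) then some p else none
  have hact : Primrec act := by
    have hl : Primrec fun l : List ℕ => l.length.unpair :=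
      Primrec.unpair.comp Primrec.list_length
    refine Primrec.option_bind (Primrec.decode.comp (Primrec.fst.comp hl)) ?_
    refine Primrec.ite (PrimrecPred.and ?_ (PrimrecPred.and ?_ (PrimrecPred.not
      (PrimrecPred.and ?_ ?_)))) (Primrec.option_some.comp Primrec.snd) (Primrec.const none)
    · exact Primrec.eq.comp (Primrec.encode.comp Primrec.snd)
        (Primrec.fst.comp (hl.comp Primrec.fst))
    · exact PrimrecRel.comp h1 Primrec.snd
        (Primrec.list_take.comp (Primrec.snd.comp (hl.comp Primrec.fst)) Primrec.fst)
    · exact Primrec.nat_lt.comp (Primrec.const 0) (Primrec.snd.comp (hl.comp Primrec.fst))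
    · exact PrimrecRel.comp h1 Primrec.snd (Primrec.list_take.comp (Primrec.pred.comp
        (Primrec.snd.comp (hl.comp Primrec.fst))) Primrec.fst)
  have hact' : ∀ (O : ℕ → ℕ) (s : ℕ) (p : ℕ × List Bool), act (res O s) = some p →
      Encodable.encode p = s.unpair.1 ∧ R p (res O s.unpair.2) ∧
        ¬(0 < s.unpair.2 ∧ R p (res O (s.unpair.2 - 1))) := by
    intro O s p h
    obtain ⟨q, -, hq⟩ := Option.bind_eq_some_iff.1 h
    split_ifs at hq with h4
    obtain rfl := Option.some_injective _ hq
    have h5 := Nat.unpair_right_le s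
    rwa [length_res, take_res O h5, take_res O (by omega)] at h4
  have hfst : ∀ (O : ℕ → ℕ) s p, act (res O s) = some p → p.1 ≤ s := by
    intro O s p h
    have h4 := (hact' O s p h).1
    exact (Nat.left_le_pair p.1 (Encodable.encode p.2)).trans
      (h4.trans_le (Nat.unpair_left_le s))
  have hinj : ∀ (O : ℕ → ℕ) s t p, act (res O s) = some p → act (res O t) = some p → s = t := by
    intro O s t p hs ht
    obtain ⟨s1, s2, s3⟩ := hact' O s p hs
    obtain ⟨t1, t2, t3⟩ := hact' O t p ht
    have h4 : ∀ i j, R p (res O i) → ¬(0 < j ∧ R p (res O (j - 1))) → j ≤ i := by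
      intro i j hi hj
      by_contra! hij
      exact hj ⟨by omega, h2 _ _ _ (res_prefix O (by omega)) hi⟩
    rw [← Nat.pair_unpair s, ← Nat.pair_unpair t, ← s1, ← t1,
      le_antisymm (h4 _ _ t2 s3) (h4 _ _ s2 t3)]
  let a : List ℕ → ℕ → Option (ℕ × List Bool) := fun l t => act (l.take t)
  have ha : Primrec₂ a := hact.comp₂ (Primrec.list_take.comp Primrec.snd Primrec.fst)
  let aO : (ℕ → ℕ) → ℕ → Option (ℕ × List Bool) := fun O t => act (res O t)
  have haO : ∀ O s p σ, Fits (a (res O s)) s p σ ↔ Fits (aO O) s p σ := by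
    intro O s p σ
    have h4 : ∀ t ≤ s, a (res O s) t = aO O t := fun t ht => by simp [a, aO, take_res O ht]
    rw [Fits, Fits, h4 s le_rfl, alloc_congr fun t ht => h4 t (le_of_lt ht),
      alloc_congr (s := s + 1) fun t ht => h4 t (by omega)]
  let g : ℕ → List ℕ → Option ℕ := fun m l =>
    (Encodable.decode m : Option (List Bool)).bind fun σ => (act l).bind fun p =>
      if Fits (a l) l.length p σ then some (Encodable.encode p.2) else none
  have hg : Primrec₂ g := by
    refine Primrec.option_bind (Primrec.decode.comp Primrec.fst) (Primrec.option_bind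
      (hact.comp (Primrec.snd.comp Primrec.fst)) (Primrec.ite ?_
      (Primrec.option_some.comp (Primrec.encode.comp (Primrec.snd.comp Primrec.snd)))
      (Primrec.const none)))
    have hl : Primrec fun x : ((ℕ × List ℕ) × List Bool) × ℕ × List Bool => x.1.1.2 :=
      Primrec.snd.comp (Primrec.fst.comp Primrec.fst)
    exact primrec_fits (a := fun x : ((ℕ × List ℕ) × List Bool) × ℕ × List Bool => a x.1.1.2)
      (ha.comp (hl.comp Primrec.fst) Primrec.snd) (Primrec.list_length.comp hl)
      Primrec.snd (Primrec.snd.comp Primrec.fst)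
  have hgs : ∀ O s σ y, g (Encodable.encode σ) (res O s) = some y ↔
      ∃ p, Fits (aO O) s p σ ∧ Encodable.encode p.2 = y := by
    intro O s σ y
    simp only [g, Encodable.encodek, Option.bind_some, Option.bind_eq_some_iff, length_res, haO,
      Option.ite_none_right_eq_some, Option.some.injEq]
    exact exists_congr fun p => and_iff_right_of_imp fun h => h.1.1
  obtain ⟨c, hc⟩ := exists_code_search hg
  have hfits : ∀ O σ τ, τ ∈ evalStr c O σ → ∃ s p, Fits (aO O) s p σ ∧ p.2 = τ := by
    intro O σ τ h
    obtain ⟨m, hm, hτ⟩ := Part.mem_bind_iff.1 h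
    obtain ⟨s, hs⟩ := (hc O _).1 m hm
    obtain ⟨p, hp, rfl⟩ := (hgs O s σ m).1 hs
    exact ⟨s, p, hp, by simpa [eq_comm] using hτ⟩
  have hpf : PrefixFreeMachine c := by
    intro O σ τ hp hσ hτ
    obtain ⟨s, p, hs, -⟩ := hfits O σ _ (Part.get_mem hσ)
    obtain ⟨t, q, ht, -⟩ := hfits O τ _ (Part.get_mem hτ)
    obtain rfl := hs.eq_of_prefix ht hp
    obtain rfl := Option.some_injective _ (hs.1.symm.trans ht.1)
    exact hp.eq_of_length (hs.2.1.trans ht.2.1.symm)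
  obtain ⟨d, hd⟩ := hu.2 c hpf
  refine ⟨d + 1, fun p hp => ?_⟩
  have hex := (h3 p).1 hp
  let t := Nat.find hex
  have hs : aO O (Nat.pair (Encodable.encode p) t) = some p := by
    have h4 : ¬(0 < t ∧ R p (res O (t - 1))) := fun h => Nat.find_min hex (by omega) h.2
    have h5 : t ≤ Nat.pair (Encodable.encode p) t := Nat.right_le_pair _ _
    simp only [aO, act, length_res, Nat.unpair_pair, Encodable.encodek, Option.bind_some,
      take_res O h5, take_res O ((Nat.sub_le t 1).trans h5)]
    exact if_pos ⟨trivial, Nat.find_spec hex, h4⟩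
  obtain ⟨σ, hσ⟩ := exists_fits hs (hfst O _ _ hs) (pos_le_one (hfst O) (hinj O)
    (fun s p h => (h3 p).2 ⟨_, (hact' O s p h).2.1⟩) hw _)
  have hτ : p.2 ∈ evalStr c O σ := by
    have hdom := (hc O (Encodable.encode σ)).2 _ (Option.isSome_iff_exists.2
      ⟨_, (hgs O _ σ _).2 ⟨p, hσ, rfl⟩⟩)
    obtain ⟨m, hm⟩ := Part.dom_iff_mem.1 hdom
    obtain ⟨s, hs⟩ := (hc O _).1 m hm
    obtain ⟨q, hq, rfl⟩ := (hgs O s σ m).1 hs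
    obtain rfl := hσ.eq_of_prefix hq List.prefix_rfl
    obtain rfl := Option.some_injective _ (hσ.1.symm.trans hq.1)
    exact Part.mem_bind_iff.2 ⟨_, hm, by simp⟩
  obtain ⟨σ', h6, h7⟩ := hd O σ p.2 hτ
  exact ⟨σ', h6, by rw [hσ.2.1] at h7; omega⟩

theorem K_le_iff {u : OracleCode} {O : ℕ → ℕ} {τ : List Bool} {k : ℕ} :
    K u O τ ≤ k ↔ ∃ p, τ ∈ evalStr u O p ∧ p.length ≤ k := by
  constructor
  · intro h
    by_contra! hn
    have : ((k + 1 : ℕ) : ℕ∞) ≤ K u O τ := le_iInf₂ fun p hp => by exact_mod_cast hn p hp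
    exact absurd (this.trans h) (by norm_cast; omega)
  · rintro ⟨p, hp, hk⟩
    exact (iInf₂_le p hp).trans (by exact_mod_cast hk)

theorem lkle_iff {u : OracleCode} {A B : Set ℕ} :
    LKle u A B ↔ ∃ d : ℕ, ∀ τ p, τ ∈ evalStr u (chi A) p →
      ∃ p', τ ∈ evalStr u (chi B) p' ∧ p'.length ≤ p.length + d := by
  refine exists_congr fun d => ⟨fun h τ p hp => ?_, fun h τ => ?_⟩
  · refine K_le_iff.1 ((h τ).trans ?_)
    push_cast
    gcongr
    exact K_le_iff.2 ⟨p, hp, le_rfl⟩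
  · cases hK : K u (chi A) τ with
    | top => simp
    | coe k =>
      obtain ⟨p, hp, hk⟩ := K_le_iff.1 hK.le
      obtain ⟨p', hp', hd⟩ := h τ p hp
      exact_mod_cast K_le_iff.2 ⟨p', hp', hd.trans (by omega)⟩

/-- The strings that the machine `u` compresses by more than `c` bits. -/
def compressible (u : OracleCode) (O : ℕ → ℕ) (c : ℕ) : Set (List Bool) :=
  {τ | ∃ p, τ ∈ evalStr u O p ∧ p.length + c < τ.length}

theorem compressible_anti (u : OracleCode) (O : ℕ → ℕ) : Antitone (compressible u O) := by
  rintro c c' h τ ⟨p, hp, hl⟩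
  exact ⟨p, hp, by omega⟩

theorem sig_compressible (u : OracleCode) (O : ℕ → ℕ) :
    Sig O fun q : ℕ × List Bool => q.2 ∈ compressible u O q.1 := by
  refine Sig.ex (P := fun (q : ℕ × List Bool) p => q.2 ∈ evalStr u O p ∧
    p.length + q.1 < q.2.length) (Sig.and ?_ (Sig.of_primrec ?_))
  · exact (Sig.mem_evalStr u).comp (f := fun x : (ℕ × List Bool) × List Bool => (x.2, x.1.2))
      (Primrec.pair Primrec.snd (Primrec.snd.comp Primrec.fst))
  · exact Primrec.nat_lt.comp (Primrec.nat_add.comp (Primrec.list_length.comp Primrec.snd)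
      (Primrec.fst.comp Primrec.fst)) (Primrec.list_length.comp (Primrec.snd.comp Primrec.fst))

theorem PrefixFreeMachine.prefixFree {u : OracleCode} (hu : PrefixFreeMachine u) (O : ℕ → ℕ) :
    PrefixFree {p | (evalStr u O p).Dom} := fun σ hσ τ hτ h => hu O σ τ h hσ hτ

theorem PrefixFreeMachine.tsum_le {u : OracleCode} (hu : PrefixFreeMachine u) (O : ℕ → ℕ)
    {ι : Type*} {p : ι → List Bool} (hp : Function.Injective p)
    (h : ∀ i, (evalStr u O (p i)).Dom) : ∑' i, (2⁻¹ : ℝ≥0∞) ^ (p i).length ≤ 1 := by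
  let f : ι → {p | (evalStr u O p).Dom} := fun i => ⟨p i, h i⟩
  have hf : Function.Injective f := fun i j hij => hp (congrArg Subtype.val hij)
  exact (ENNReal.tsum_comp_le_tsum_of_injective hf
    fun q : {p | (evalStr u O p).Dom} => (2⁻¹ : ℝ≥0∞) ^ (q : List Bool).length).trans
    (hu.prefixFree O).wt_le_one

theorem two_inv_pow_anti {m n : ℕ} (h : m ≤ n) : (2⁻¹ : ℝ≥0∞) ^ n ≤ 2⁻¹ ^ m :=
  pow_le_pow_right_of_le_one' (by simp) h

theorem mu_compressible_le {u : OracleCode} (hu : PrefixFreeMachine u) (O : ℕ → ℕ) (c : ℕ) :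
    mu (Cyl (compressible u O c)) ≤ 2⁻¹ ^ c := by
  refine (mu_Cyl_le _).trans ?_
  choose p hp hl using fun τ : compressible u O c => τ.2
  calc wt (compressible u O c) ≤ ∑' τ : compressible u O c, 2⁻¹ ^ c * 2⁻¹ ^ (p τ).length := by
        refine ENNReal.tsum_le_tsum fun τ => ?_
        rw [← pow_add]
        exact two_inv_pow_anti (by have := hl τ; omega)
    _ ≤ 2⁻¹ ^ c := by
        rw [ENNReal.tsum_mul_left]
        refine mul_le_of_le_one_right' (hu.tsum_le O (fun τ τ' h => ?_)
          fun τ => Part.dom_iff_mem.2 ⟨_, hp τ⟩)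
        exact Subtype.ext (Part.mem_unique (h ▸ hp τ) (hp τ'))

theorem Cyl_mono {V W : Set (List Bool)} (h : V ⊆ W) : Cyl V ⊆ Cyl W := by
  intro X hX
  rw [mem_Cyl] at hX ⊢
  exact hX.imp fun n hn => h hn

theorem exists_not_mem_compressible {u : OracleCode} (hu : PrefixFreeMachine u) {A : Set ℕ}
    {X : ℕ → Bool} (hX : MLRandom A X) : ∃ c, X ∉ Cyl (compressible u (chi A) c) := by
  have := hX (fun c => Cyl (compressible u (chi A) c)) ⟨compressible u (chi A),
    ceSeqIn_iff.2 (sig_compressible u _), fun _ => rfl,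
    fun n => Cyl_mono (compressible_anti u _ n.le_succ), mu_compressible_le hu _⟩
  simpa using this

/-- A uniformly c.e. sequence of open sets has a uniformly c.e. prefix-free presentation. -/
theorem exists_prefixFree {O : ℕ → ℕ} {W : ℕ → Set (List Bool)}
    (hW : Sig O fun q : ℕ × List Bool => q.2 ∈ W q.1) :
    ∃ V : ℕ → Set (List Bool), (Sig O fun q : ℕ × List Bool => q.2 ∈ V q.1) ∧
      ∀ n, PrefixFree (V n) ∧ Cyl (V n) = Cyl (W n) := by
  obtain ⟨R, h1, h2, h3⟩ := hW
  let E : ℕ × List Bool → List ℕ → Prop := fun q l =>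
    ∃ t < q.2.length + 1, R (q.1, q.2.take t) l
  have hE : PrimrecRel E := by
    have h : PrimrecRel fun (t : ℕ) (x : (ℕ × List Bool) × List ℕ) =>
        R (x.1.1, x.1.2.take t) x.2 :=
      h1.comp (Primrec.pair (Primrec.fst.comp (Primrec.fst.comp Primrec.snd))
        (Primrec.list_take.comp Primrec.fst (Primrec.snd.comp (Primrec.fst.comp Primrec.snd))))
        (Primrec.snd.comp Primrec.snd)
    refine PrimrecPred.of_eq (h.exists_mem_list.comp (Primrec.list_range.comp (Primrec.succ.comp
      (Primrec.list_length.comp (Primrec.snd.comp Primrec.fst)))) Primrec.id) fun x => ?_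
    simp [E]
  let D : ℕ → Set (List Bool) := fun n => {ρ | E (n, ρ) (res O ρ.length)}
  let V : ℕ → Set (List Bool) := fun n => {ρ | ρ ∈ D n ∧ ∀ j < ρ.length, ρ.take j ∉ D n}
  refine ⟨V, ?_, fun n => ⟨?_, ?_⟩⟩
  · refine Sig.of_rel (R := fun q l => q.2.length ≤ l.length ∧ E q (l.take q.2.length) ∧
      ∀ j < q.2.length, ¬E (q.1, q.2.take j) (l.take j)) ?_ fun q => ?_
    · have hq : Primrec fun x : (ℕ × List Bool) × List ℕ => x.1.2.length :=
        Primrec.list_length.comp (Primrec.snd.comp Primrec.fst)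
      refine PrimrecPred.and (Primrec.nat_le.comp hq (Primrec.list_length.comp Primrec.snd))
        (PrimrecPred.and (hE.comp Primrec.fst (Primrec.list_take.comp hq Primrec.snd)) ?_)
      have h : PrimrecRel fun (j : ℕ) (x : (ℕ × List Bool) × List ℕ) =>
          ¬E (x.1.1, x.1.2.take j) (x.2.take j) :=
        (PrimrecPred.not (hE.comp (Primrec.pair (Primrec.fst.comp (Primrec.fst.comp Primrec.snd))
          (Primrec.list_take.comp Primrec.fst (Primrec.snd.comp (Primrec.fst.comp Primrec.snd))))
          (Primrec.list_take.comp Primrec.fst (Primrec.snd.comp Primrec.snd))))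
      refine PrimrecPred.of_eq (h.forall_mem_list.comp (Primrec.list_range.comp hq)
        Primrec.id) fun x => ?_
      simp
    · have key : ∀ s, q.2.length ≤ s → ((E q ((res O s).take q.2.length) ∧
          ∀ j < q.2.length, ¬E (q.1, q.2.take j) ((res O s).take j)) ↔ q.2 ∈ V q.1) := by
        intro s hs
        rw [take_res O hs]
        refine and_congr Iff.rfl (forall₂_congr fun j hj => not_congr ?_)
        simp only [D, Set.mem_ofPred_eq]
        rw [take_res O (by omega), List.length_take_of_le hj.le]
      constructor
      · intro h
        exact ⟨q.2.length, by simp, (key _ le_rfl).2 h⟩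
      · rintro ⟨s, hs, h⟩
        exact (key s (by simpa using hs)).1 h
  · intro σ hσ τ hτ h
    by_contra hne
    have hl : σ.length < τ.length :=
      h.length_le.lt_of_ne fun e => hne (h.eq_of_length e)
    exact hτ.2 _ hl (by rw [← List.prefix_iff_eq_take.1 h]; exact hσ.1)
  · ext X
    constructor
    · intro hX
      obtain ⟨m, ⟨t, ht, hR⟩, -⟩ := mem_Cyl.1 hX
      rw [length_res] at ht
      simp only at hR
      rw [take_res X (by omega)] at hR
      exact mem_Cyl.2 ⟨t, (h3 (n, res X t)).2 ⟨_, hR⟩⟩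
    · intro hX
      obtain ⟨m, hm⟩ := mem_Cyl.1 hX
      obtain ⟨s, hs⟩ := (h3 (n, res X m)).1 hm
      have hex : ∃ N, res X N ∈ D n := by
        refine ⟨max m s, m, ?_, ?_⟩
        · simp
        · simp only [length_res]
          rw [take_res X (le_max_left _ _)]
          exact h2 _ _ _ (res_prefix O (le_max_right _ _)) hs
      classical
      refine mem_Cyl.2 ⟨Nat.find hex, Nat.find_spec hex, fun j hj => ?_⟩
      rw [length_res] at hj
      rw [take_res X hj.le]
      exact Nat.find_min hex hj

theorem two_pow_mul_two_inv_pow (n k : ℕ) : (2 : ℝ≥0∞) ^ n * 2⁻¹ ^ (k + n) = 2⁻¹ ^ k := by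
  rw [pow_add, mul_left_comm, ← mul_pow, ENNReal.mul_inv_cancel (by simp) (by simp)]
  simp

theorem random_of_not_mem_compressible {u : OracleCode} (hu : UniversalPFM u) {A : Set ℕ}
    {X : ℕ → Bool} {c : ℕ} (hX : X ∉ Cyl (compressible u (chi A) c)) : MLRandom A X := by
  rintro U ⟨W, hW, hUW, -, hmu⟩ hXU
  obtain ⟨V, hV, hVW⟩ := exists_prefixFree (ceSeqIn_iff.1 hW)
  have hwt : ∀ n, wt (V n) ≤ 2⁻¹ ^ n := fun n => by
    rw [← (hVW n).1.mu_Cyl, (hVW n).2, ← hUW]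
    exact hmu n
  let P : Set (ℕ × List Bool) := {q | ∃ n, q.2 ∈ V (2 * n + 1) ∧ q.1 + n = q.2.length}
  have hP : Sig (chi A) (· ∈ P) := by
    refine Sig.ex (P := fun (q : ℕ × List Bool) n => q.2 ∈ V (2 * n + 1) ∧ q.1 + n = q.2.length)
      (Sig.and ?_ (Sig.of_primrec ?_))
    · exact hV.comp (f := fun x : (ℕ × List Bool) × ℕ => (2 * x.2 + 1, x.1.2))
        (Primrec.pair (Primrec.succ.comp (Primrec.nat_mul.comp (Primrec.const 2) Primrec.snd))
          (Primrec.snd.comp Primrec.fst))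
    · exact Primrec.eq.comp (Primrec.nat_add.comp (Primrec.fst.comp Primrec.fst) Primrec.snd)
        (Primrec.list_length.comp (Primrec.snd.comp Primrec.fst))
  have hw : ∑' q : P, (2⁻¹ : ℝ≥0∞) ^ q.1.1 ≤ 1 := by
    choose n hn hk using fun q : P => q.2
    let f : P → Σ n, V (2 * n + 1) := fun q => ⟨n q, q.1.2, hn q⟩
    have hf : Function.Injective f := by
      intro q q' h
      have e1 : n q = n q' := congrArg Sigma.fst h
      have e2 : q.1.2 = q'.1.2 := congrArg (fun x : Σ n, V (2 * n + 1) => (x.2 : List Bool)) h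
      have e3 := hk q
      rw [e1, e2, ← hk q'] at e3
      exact Subtype.ext (Prod.ext (Nat.add_right_cancel e3) e2)
    let w : (Σ n, V (2 * n + 1)) → ℝ≥0∞ := fun x => 2 ^ x.1 * 2⁻¹ ^ (x.2 : List Bool).length
    calc ∑' q : P, (2⁻¹ : ℝ≥0∞) ^ q.1.1 = ∑' q, w (f q) := by
          refine tsum_congr fun q => ?_
          simp only [w, f]
          rw [← hk q, two_pow_mul_two_inv_pow]
      _ ≤ ∑' x, w x := ENNReal.tsum_comp_le_tsum_of_injective hf w
      _ = ∑' n, 2 ^ n * wt (V (2 * n + 1)) := by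
          rw [ENNReal.tsum_sigma']
          simp [w, wt, ENNReal.tsum_mul_left]
      _ ≤ ∑' n : ℕ, 2⁻¹ ^ (n + 1) := by
          refine ENNReal.tsum_le_tsum fun n => ?_
          rw [← two_pow_mul_two_inv_pow n (n + 1), show n + 1 + n = 2 * n + 1 by ring]
          gcongr
          exact hwt _
      _ = 1 := by
          rw [ENNReal.tsum_geometric_add_one, ENNReal.one_sub_inv_two, inv_inv]
          exact ENNReal.inv_mul_cancel (by simp) (by simp)
  obtain ⟨d, hd⟩ := kraft_chaitin hu hP hw
  let n := c + d + 1
  have hXn := Set.mem_iInter.1 hXU (2 * n + 1)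
  rw [hUW, ← (hVW _).2] at hXn
  obtain ⟨m, hm⟩ := mem_Cyl.1 hXn
  have hlen : 2 * n + 1 ≤ m := by
    by_contra! h
    have h4 : (2⁻¹ : ℝ≥0∞) ^ m ≤ 2⁻¹ ^ (2 * n + 1) := by
      have := (measure_mono (cyl_subset_Cyl hm)).trans ((mu_Cyl_le _).trans (hwt _))
      simpa [mu_cyl] using this
    rw [← ENNReal.inv_pow, ← ENNReal.inv_pow, ENNReal.inv_le_inv] at h4
    exact absurd h4 (not_le.2 (by exact_mod_cast Nat.pow_lt_pow_right one_lt_two h))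
  obtain ⟨σ, hσ, hl⟩ := hd (m - n, res X m) ⟨n, hm, by simp; omega⟩
  refine hX (mem_Cyl.2 ⟨m, σ, hσ, ?_⟩)
  simp only at hl
  rw [length_res]
  omega

theorem lr_of_lk {u : OracleCode} (hu : UniversalPFM u) {A B : Set ℕ} (h : LKle u A B) :
    LRle A B := by
  obtain ⟨d, hd⟩ := lkle_iff.1 h
  intro X hX
  obtain ⟨c, hc⟩ := exists_not_mem_compressible hu.1 hX
  refine random_of_not_mem_compressible hu (c := c + d) fun hX' => hc (Cyl_mono ?_ hX')
  rintro τ ⟨p, hp, hl⟩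
  obtain ⟨p', hp', hl'⟩ := hd τ p hp
  exact ⟨p', hp', by omega⟩

theorem isClopen_cyl (σ : List Bool) : IsClopen (cyl σ) := by
  have : cyl σ = ⋂ i : Fin σ.length, (fun X : ℕ → Bool => X i) ⁻¹' {σ.get i} := by
    ext X
    simp [mem_cyl_iff_forall]
  rw [this]
  exact isClopen_iInter_of_finite fun i => (isClopen_discrete _).preimage (continuous_apply _)

theorem isOpen_Cyl (W : Set (List Bool)) : IsOpen (Cyl W) := by
  rw [Cyl_eq_iUnion]
  exact isOpen_iUnion fun σ => (isClopen_cyl σ).isOpen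

/-- The concatenations of `k` elements of `S`. -/
def concats (S : Set (List Bool)) (k : ℕ) : Set (List Bool) :=
  {τ | ∃ F : List (List Bool), (F.length = k ∧ F.flatten = τ) ∧ ∀ ρ ∈ F, ρ ∈ S}

theorem wt_concats_le (S : Set (List Bool)) (k : ℕ) : wt (concats S k) ≤ wt S ^ k := by
  induction k with
  | zero =>
    have : concats S 0 = {[]} := by
      ext τ
      simp [concats, eq_comm]
    rw [this, wt]
    simp
  | succ k ih =>
    let f : S × concats S k → concats S (k + 1) := fun q => ⟨q.1 ++ q.2, by
      obtain ⟨⟨ρ, hρ⟩, τ, F, ⟨hl, rfl⟩, hF⟩ := q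
      exact ⟨ρ :: F, ⟨by simp [hl], by simp⟩, by simpa using ⟨hρ, hF⟩⟩⟩
    have hf : Function.Surjective f := by
      rintro ⟨_, F, ⟨hl, rfl⟩, hF⟩
      cases F with
      | nil => simp at hl
      | cons ρ F =>
        simp only [List.mem_cons, forall_eq_or_imp] at hF
        exact ⟨⟨⟨ρ, hF.1⟩, F.flatten, F, ⟨by simpa using hl, rfl⟩, hF.2⟩, by simp [f]⟩
    refine (ENNReal.tsum_le_tsum_comp_of_surjective hf _).trans ?_
    rw [ENNReal.tsum_prod', pow_succ' (wt S)]
    refine le_trans (le_of_eq ?_) (mul_le_mul_right ih (wt S))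
    simp only [f, List.length_append, pow_add _ (List.length _), ENNReal.tsum_mul_left,
      ENNReal.tsum_mul_right, wt]

theorem sig_concats {O : ℕ → ℕ} {S : Set (List Bool)} (hS : Sig O (· ∈ S)) :
    Sig O fun q : ℕ × List Bool => q.2 ∈ concats S q.1 := by
  refine Sig.ex (P := fun (q : ℕ × List Bool) (F : List (List Bool)) =>
    (F.length = q.1 ∧ F.flatten = q.2) ∧ ∀ ρ ∈ F, ρ ∈ S) (Sig.and (Sig.of_primrec ?_) ?_)
  · exact PrimrecPred.and (Primrec.eq.comp (Primrec.list_length.comp Primrec.snd)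
      (Primrec.fst.comp Primrec.fst)) (Primrec.eq.comp (Primrec.list_flatten.comp Primrec.snd)
      (Primrec.snd.comp Primrec.fst))
  · exact Sig.forall_mem (P := fun (_ : ℕ × List Bool) ρ => ρ ∈ S) (hS.comp Primrec.snd)

theorem mlTest_concats {A : Set ℕ} {S : Set (List Bool)} (hS : Sig (chi A) (· ∈ S))
    (hw : wt S ≤ 2⁻¹) : MLTest A fun k => Cyl (concats S k) := by
  refine ⟨concats S, ceSeqIn_iff.2 (sig_concats hS), fun _ => rfl, fun k X hX => ?_, fun k =>
    (mu_Cyl_le _).trans ((wt_concats_le S k).trans (by gcongr))⟩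
  change X ∈ Cyl _ at hX
  rw [Cyl_eq_iUnion, Set.mem_iUnion] at hX
  obtain ⟨⟨_, F, ⟨hl, rfl⟩, hF⟩, hX⟩ := hX
  have hF' : (F.take k).flatten ∈ concats S k :=
    ⟨F.take k, ⟨by simp [hl], rfl⟩, fun ρ hρ => hF ρ (List.mem_of_mem_take hρ)⟩
  refine cyl_subset_Cyl hF' (cyl_antitone ?_ hX)
  exact ⟨(F.drop k).flatten, by rw [← List.flatten_append, List.take_append_drop]⟩

/-- If every random sequence outside `Cyl W` avoids some set of concatenations of elements of `S`,
then inside some cylinder `S` is almost covered by `Cyl W`. -/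
theorem exists_cyl_of_avoid {S W : Set (List Bool)} (hW : mu (Cyl W) < 1)
    (h : ∀ X, X ∉ Cyl W → ∃ k, X ∉ Cyl (concats S k)) :
    ∃ σ, mu (cyl σ \ Cyl W) ≠ 0 ∧ ∀ ρ ∈ S, mu (cyl (σ ++ ρ) \ Cyl W) = 0 := by
  by_contra! hcon
  let T := {F : List (List Bool) // (∀ ρ ∈ F, ρ ∈ S) ∧ mu (cyl F.flatten \ Cyl W) ≠ 0}
  have hT : ∀ F : T, ∃ G : T, ∃ ρ, G.1 = F.1 ++ [ρ] := by
    rintro ⟨F, hF, hmu⟩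
    obtain ⟨ρ, hρ, hne⟩ := hcon _ hmu
    refine ⟨⟨F ++ [ρ], ?_, by simpa using hne⟩, ρ, rfl⟩
    intro τ hτ
    rcases List.mem_append.1 hτ with hτ | hτ
    · exact hF τ hτ
    · rwa [List.mem_singleton.1 hτ]
  choose next ρ hnext using hT
  let F₀ : T := ⟨[], by simp, by
    simp only [List.flatten_nil, cyl_nil, ← Set.compl_eq_univ_sdiff]
    rw [prob_compl_eq_one_sub (measurableSet_Cyl W)]
    exact (tsub_pos_of_lt hW).ne'⟩
  let F : ℕ → T := fun k => next^[k] F₀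
  have hF : ∀ k, (F (k + 1)).1 = (F k).1 ++ [ρ (F k)] := fun k => by
    rw [← hnext]
    simp only [F, Function.iterate_succ_apply']
  obtain ⟨X, hX⟩ := IsCompact.nonempty_iInter_of_sequence_nonempty_isCompact_isClosed
    (fun k => cyl (F k).1.flatten \ Cyl W)
    (fun k => Set.sdiff_subset_sdiff_left (cyl_antitone (by simp [hF k])))
    (fun k => nonempty_of_measure_ne_zero (F k).2.2)
    (((isClopen_cyl _).isClosed.sdiff (isOpen_Cyl W)).isCompact)
    (fun k => (isClopen_cyl _).isClosed.sdiff (isOpen_Cyl W))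
  rw [Set.mem_iInter] at hX
  have hlen : ∀ k, (F k).1.length = k := by
    intro k
    induction k with
    | zero => rfl
    | succ k ih => rw [hF, List.length_append, ih]; rfl
  obtain ⟨k, hk⟩ := h X (hX 0).2
  have hmem : (F k).1.flatten ∈ concats S k := ⟨_, ⟨hlen k, rfl⟩, (F k).2.1⟩
  exact hk (cyl_subset_Cyl hmem (hX k).1)

/-- The block of coordinates attached to `i`, of size `i.unpair.1`. -/
def block (a i : ℕ) : Finset ℕ := (Finset.range i.unpair.1).image fun j => a + Nat.pair i j

theorem forall_mem_block {a i : ℕ} {p : ℕ → Prop} :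
    (∀ j ∈ block a i, p j) ↔ ∀ j < i.unpair.1, p (a + Nat.pair i j) := by
  simp [block]

theorem card_block (a i : ℕ) : (block a i).card = i.unpair.1 := by
  rw [block, Finset.card_image_of_injective, Finset.card_range]
  intro j j' h
  simpa using h

theorem disjoint_block (a : ℕ) {i i' : ℕ} (h : i ≠ i') : Disjoint (block a i) (block a i') := by
  rw [Finset.disjoint_left]
  simp only [block, Finset.mem_image]
  rintro _ ⟨j, -, rfl⟩ ⟨j', -, h'⟩
  exact h (by simpa using congrArg (fun x => (Nat.unpair (x - a)).1) h'.symm)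

/-- The strings deciding that all the coordinates in the block of `i` vanish. -/
def zeroBlock (i : ℕ) : Set (List Bool) :=
  {ρ | ρ.length = Nat.pair i i.unpair.1 ∧ ∀ j < i.unpair.1, ρ[Nat.pair i j]? = some false}

theorem wt_zeroBlock (i : ℕ) : wt (zeroBlock i) = 2⁻¹ ^ i.unpair.1 := by
  rw [← (prefixFree_of_length fun ρ h => h.1).mu_Cyl, ← card_block 0 i, ← mu_forall_false]
  congr 1
  ext X
  rw [mem_Cyl, Set.mem_ofPred_eq, forall_mem_block]
  have h : (∀ j < i.unpair.1, (res X (Nat.pair i i.unpair.1))[Nat.pair i j]? = some false) ↔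
      ∀ j < i.unpair.1, X (0 + Nat.pair i j) = false :=
    forall₂_congr fun j hj => by
      rw [getElem?_res X (Nat.pair_lt_pair_right i hj), zero_add, Option.some_inj]
  rw [← h]
  constructor
  · rintro ⟨n, hn, hX⟩
    rw [length_res] at hn
    rwa [hn] at hX
  · intro hX
    exact ⟨_, length_res _ _, hX⟩

theorem wt_iUnion_zeroBlock_le (I : Set ℕ) :
    wt (⋃ i : I, zeroBlock i) ≤ ∑' i : I, 2⁻¹ ^ (i : ℕ).unpair.1 := by
  refine (ENNReal.tsum_iUnion_le_tsum (fun σ : List Bool => (2⁻¹ : ℝ≥0∞) ^ σ.length)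
    fun i : I => zeroBlock i).trans (le_of_eq (tsum_congr fun i => ?_))
  exact wt_zeroBlock i

theorem primrec_unpair_fst : Primrec fun i : ℕ => i.unpair.1 := Primrec.fst.comp Primrec.unpair

theorem sig_iUnion_zeroBlock {O : ℕ → ℕ} {I : Set ℕ} (hI : Sig O (· ∈ I)) :
    Sig O (· ∈ ⋃ i : I, zeroBlock i) := by
  refine (Sig.ex (P := fun (ρ : List Bool) i => i ∈ I ∧ ρ ∈ zeroBlock i)
    (Sig.and (hI.comp Primrec.snd) (Sig.of_primrec ?_))).of_eq fun ρ => by simp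
  have hi : Primrec fun x : List Bool × ℕ => x.2.unpair.1 := primrec_unpair_fst.comp Primrec.snd
  refine PrimrecPred.and (Primrec.eq.comp (Primrec.list_length.comp Primrec.fst)
    (Primrec₂.natPair.comp Primrec.snd hi)) ?_
  have h : PrimrecRel fun (j : ℕ) (x : List Bool × ℕ) => x.1[Nat.pair x.2 j]? = some false :=
    Primrec.eq.comp (Primrec.list_getElem?.comp (Primrec.fst.comp Primrec.snd)
      (Primrec₂.natPair.comp (Primrec.snd.comp Primrec.snd) Primrec.fst)) (Primrec.const _)
  exact (h.forall_mem_list.comp (Primrec.list_range.comp hi) Primrec.id).of_eq fun x => by simp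

/-- The list of all binary strings of length `n`. -/
def allStr : ℕ → List (List Bool)
  | 0 => [[]]
  | n + 1 => (allStr n).flatMap fun ρ => [ρ ++ [false], ρ ++ [true]]

theorem mem_allStr {n : ℕ} {ρ : List Bool} : ρ ∈ allStr n ↔ ρ.length = n := by
  induction n generalizing ρ with
  | zero => simp [allStr]
  | succ n ih =>
    simp only [allStr, List.mem_flatMap, ih, List.mem_cons, List.not_mem_nil, or_false]
    constructor
    · rintro ⟨τ, rfl, rfl | rfl⟩ <;> simp
    · intro h
      rcases List.eq_nil_or_concat ρ with rfl | ⟨τ, b, rfl⟩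
      · simp at h
      · refine ⟨τ, by simpa using h, ?_⟩
        cases b <;> simp

theorem primrec_allStr : Primrec allStr := by
  have hf : Primrec₂ fun (_ : ℕ × List (List Bool)) (ρ : List Bool) =>
      [ρ ++ [false], ρ ++ [true]] :=
    Primrec.list_cons.comp (Primrec.list_append.comp Primrec.snd (Primrec.const _))
      (Primrec.list_cons.comp (Primrec.list_append.comp Primrec.snd (Primrec.const _))
        (Primrec.const _))
  have hg : Primrec₂ fun (_ : ℕ) (l : List (List Bool)) =>
      l.flatMap fun ρ => [ρ ++ [false], ρ ++ [true]] := Primrec.list_flatMap Primrec.snd hf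
  refine (Primrec.nat_rec₁ [[]] hg).of_eq fun n => ?_
  induction n with
  | zero => rfl
  | succ n ih => simp only [allStr, ← ih]

theorem wt_finset {G : Finset (List Bool)} {n : ℕ} (h : ∀ ρ ∈ G, ρ.length = n) :
    wt (G : Set (List Bool)) = G.card * 2⁻¹ ^ n := by
  rw [wt, Finset.tsum_subtype' G fun ρ => (2⁻¹ : ℝ≥0∞) ^ ρ.length,
    Finset.sum_congr rfl fun ρ hρ => by rw [h ρ hρ], Finset.sum_const, nsmul_eq_mul]

/-- The sequences extending `σ` which vanish on the block of `i`. -/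
def zeroCyl (σ : List Bool) (i : ℕ) : Set (ℕ → Bool) :=
  cyl σ ∩ {X | ∀ j ∈ block σ.length i, X j = false}

theorem mem_zeroCyl_iff {σ : List Bool} {i n : ℕ} (h : σ.length + Nat.pair i i.unpair.1 ≤ n)
    {X : ℕ → Bool} : X ∈ zeroCyl σ i ↔ (res X n).take σ.length = σ ∧
      ∀ j < i.unpair.1, (res X n)[σ.length + Nat.pair i j]? ≠ some true := by
  rw [zeroCyl, Set.mem_inter_iff, Set.mem_ofPred_eq, forall_mem_block, take_res X (by omega)]
  refine and_congr Iff.rfl (forall₂_congr fun j hj => ?_)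
  have := Nat.pair_lt_pair_right i hj
  rw [getElem?_res X (by omega)]
  simp

theorem zeroCyl_subset {σ : List Bool} {i n : ℕ} (h : σ.length ≤ n)
    {X : ℕ → Bool} (hX : X ∈ zeroCyl σ i) : (res X n).take σ.length = σ ∧
      ∀ j < i.unpair.1, (res X n)[σ.length + Nat.pair i j]? ≠ some true := by
  rw [zeroCyl, Set.mem_inter_iff, Set.mem_ofPred_eq, forall_mem_block] at hX
  refine ⟨by rw [take_res X h]; exact hX.1, fun j hj => ?_⟩
  by_cases hn : σ.length + Nat.pair i j < n
  · rw [getElem?_res X hn, hX.2 j hj]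
    simp
  · rw [List.getElem?_eq_none (by rw [length_res]; omega)]
    simp

theorem measurableSet_zeroCyl (σ : List Bool) (i : ℕ) : MeasurableSet (zeroCyl σ i) := by
  have : zeroCyl σ i = {X | res X (σ.length + Nat.pair i i.unpair.1) ∈
      {ρ : List Bool | ρ.take σ.length = σ ∧
        ∀ j < i.unpair.1, ρ[σ.length + Nat.pair i j]? ≠ some true}} := by
    ext X
    exact mem_zeroCyl_iff le_rfl
  rw [this]
  exact measurableSet_res _ _

/-- The blocks whose zero class inside `cyl σ` is almost contained in `Cyl W` can be enumerated,
up to a small error. -/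
theorem exists_almost_covered {O : ℕ → ℕ} {W : Set (List Bool)} (hW : Sig O (· ∈ W))
    (σ : List Bool) (m : ℕ) : ∃ J : Set ℕ, Sig O (· ∈ J) ∧
      (∀ i, mu (zeroCyl σ i \ Cyl W) = 0 → i ∈ J) ∧
      ∀ i ∈ J, mu (zeroCyl σ i \ Cyl W) ≤ 2⁻¹ ^ (i + m) := by
  let Q : ℕ → List Bool → Prop := fun i ρ => ρ.take σ.length = σ ∧
    ∀ j < i.unpair.1, ρ[σ.length + Nat.pair i j]? ≠ some true
  have hQ : PrimrecRel Q := by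
    refine PrimrecPred.and (Primrec.eq.comp (Primrec.list_take.comp (Primrec.const _) Primrec.snd)
      (Primrec.const _)) ?_
    have h : PrimrecRel fun (j : ℕ) (x : ℕ × List Bool) =>
        x.2[σ.length + Nat.pair x.1 j]? ≠ some true :=
      PrimrecPred.not (Primrec.eq.comp (Primrec.list_getElem?.comp (Primrec.snd.comp Primrec.snd)
        (Primrec.nat_add.comp (Primrec.const _) (Primrec₂.natPair.comp
          (Primrec.fst.comp Primrec.snd) Primrec.fst))) (Primrec.const _))
    exact (h.forall_mem_list.comp (Primrec.list_range.comp
      (primrec_unpair_fst.comp Primrec.fst)) Primrec.id).of_eq fun x => by simp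
  refine ⟨{i | ∃ L : ℕ, ∃ G : List (List Bool),
    (σ.length ≤ L ∧ G.length * 2 ^ (i + m) < 2 ^ L) ∧
      ∀ ρ ∈ allStr L, (¬Q i ρ ∨ ρ ∈ G) ∨ ∃ τ, ρ.take τ.length = τ ∧ τ ∈ W}, ?_, fun i hi => ?_, ?_⟩
  · refine Sig.ex (P := fun (i : ℕ) (L : ℕ) => ∃ G : List (List Bool),
      (σ.length ≤ L ∧ G.length * 2 ^ (i + m) < 2 ^ L) ∧
        ∀ ρ ∈ allStr L, (¬Q i ρ ∨ ρ ∈ G) ∨ ∃ τ, ρ.take τ.length = τ ∧ τ ∈ W) ?_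
    refine Sig.ex (P := fun (x : ℕ × ℕ) (G : List (List Bool)) =>
      (σ.length ≤ x.2 ∧ G.length * 2 ^ (x.1 + m) < 2 ^ x.2) ∧
        ∀ ρ ∈ allStr x.2, (¬Q x.1 ρ ∨ ρ ∈ G) ∨ ∃ τ, ρ.take τ.length = τ ∧ τ ∈ W) ?_
    refine Sig.and (Sig.of_primrec (PrimrecPred.and ?_ ?_)) ?_
    · exact Primrec.nat_le.comp (Primrec.const _) (Primrec.snd.comp Primrec.fst)
    · exact Primrec.nat_lt.comp (Primrec.nat_mul.comp (Primrec.list_length.comp Primrec.snd)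
        (Primrec.nat_pow.comp (Primrec.const 2) (Primrec.nat_add.comp
          (Primrec.fst.comp Primrec.fst) (Primrec.const m))))
        (Primrec.nat_pow.comp (Primrec.const 2) (Primrec.snd.comp Primrec.fst))
    · refine (Sig.forall_mem (P := fun (x : (ℕ × ℕ) × List (List Bool)) ρ =>
        (¬Q x.1.1 ρ ∨ ρ ∈ x.2) ∨ ∃ τ, ρ.take τ.length = τ ∧ τ ∈ W) ?_).comp
        (f := fun x : (ℕ × ℕ) × List (List Bool) => (x, allStr x.1.2))
        (Primrec.pair Primrec.id (primrec_allStr.comp (Primrec.snd.comp Primrec.fst)))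
      refine Sig.or (Sig.of_primrec (PrimrecPred.or ?_ ?_)) ?_
      · exact PrimrecPred.not (hQ.comp (Primrec.fst.comp (Primrec.fst.comp Primrec.fst))
          Primrec.snd)
      · have h : PrimrecRel fun (τ ρ : List Bool) => τ = ρ := Primrec.eq
        exact (h.exists_mem_list.comp (Primrec.snd.comp Primrec.fst) Primrec.snd).of_eq
          fun x => by simp
      · refine Sig.ex (P := fun (x : ((ℕ × ℕ) × List (List Bool)) × List Bool) τ =>
          x.2.take τ.length = τ ∧ τ ∈ W) (Sig.and (Sig.of_primrec ?_) (hW.comp Primrec.snd))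
        exact Primrec.eq.comp (Primrec.list_take.comp (Primrec.list_length.comp Primrec.snd)
          (Primrec.snd.comp Primrec.fst)) Primrec.snd
  · let D : ℕ → Set (ℕ → Bool) := fun L => zeroCyl σ i ∩ {X | ∀ t ≤ L, res X t ∉ W}
    have hD : ∀ L, MeasurableSet (D L) := fun L => by
      refine (measurableSet_zeroCyl σ i).inter ?_
      have : {X : ℕ → Bool | ∀ t ≤ L, res X t ∉ W} =
          ⋂ t : ℕ, ⋂ _ : t ≤ L, {X | res X t ∈ Wᶜ} := by
        ext X
        simp
      rw [this]
      exact MeasurableSet.iInter fun t => MeasurableSet.iInter fun _ => measurableSet_res _ _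
    have hanti : Antitone D := fun L L' h X hX => ⟨hX.1, fun t ht => hX.2 t (ht.trans h)⟩
    have hinter : ⋂ L, D L = zeroCyl σ i \ Cyl W := by
      ext X
      simp only [D, Set.mem_iInter, Set.mem_inter_iff, Set.mem_ofPred_eq, Set.mem_sdiff, mem_Cyl,
        not_exists]
      exact ⟨fun h => ⟨(h 0).1, fun n => (h n).2 n le_rfl⟩, fun h L => ⟨h.1, fun t _ => h.2 t⟩⟩
    have hlim := tendsto_measure_iInter_atTop (μ := mu) (fun L => (hD L).nullMeasurableSet) hanti
      ⟨0, measure_ne_top _ _⟩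
    rw [hinter, hi] at hlim
    have hpos : (0 : ℝ≥0∞) < 2⁻¹ ^ (i + m) := ENNReal.pow_pos (by simp) _
    obtain ⟨L, hL, hLn⟩ := ((hlim.eventually (gt_mem_nhds hpos)).and
      (eventually_ge_atTop (σ.length + Nat.pair i i.unpair.1))).exists
    classical
    let G : Finset (List Bool) :=
      (allStr L).toFinset.filter fun ρ => Q i ρ ∧ ∀ τ, ρ.take τ.length = τ → τ ∉ W
    have hG : ∀ ρ ∈ G, ρ.length = L := fun ρ hρ =>
      mem_allStr.1 (List.mem_toFinset.1 (Finset.mem_filter.1 hρ).1)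
    have hsub : Cyl (G : Set (List Bool)) ⊆ D L := by
      intro X hX
      obtain ⟨n, hn⟩ := mem_Cyl.1 hX
      obtain rfl : n = L := by simpa using hG _ hn
      obtain ⟨-, h1, h2⟩ := Finset.mem_filter.1 (Finset.mem_coe.1 hn)
      exact ⟨(mem_zeroCyl_iff hLn).2 h1, fun t ht => h2 _ (by rw [length_res, take_res X ht])⟩
    refine ⟨L, G.toList, ⟨by omega, ?_⟩, fun ρ hρ => ?_⟩
    · have h1 := (measure_mono hsub).trans_lt hL
      rw [(prefixFree_of_length hG).mu_Cyl, wt_finset hG, ← ENNReal.inv_pow, ← ENNReal.inv_pow,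
        ← div_eq_mul_inv, ENNReal.div_lt_iff (by simp) (by simp), mul_comm, ← div_eq_mul_inv,
        ENNReal.lt_div_iff_mul_lt (by simp) (by simp)] at h1
      rw [Finset.length_toList]
      exact_mod_cast h1
    · by_cases h1 : Q i ρ
      · by_cases h2 : ∀ τ, ρ.take τ.length = τ → τ ∉ W
        · exact Or.inl (Or.inr (Finset.mem_toList.2 (Finset.mem_filter.2
            ⟨List.mem_toFinset.2 hρ, h1, h2⟩)))
        · push Not at h2
          exact Or.inr h2
      · exact Or.inl (Or.inl h1)
  · rintro i ⟨L, G, ⟨hL, hlt⟩, h⟩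
    let G' : Finset (List Bool) := G.toFinset.filter fun ρ => ρ.length = L
    have hG' : ∀ ρ ∈ G', ρ.length = L := fun ρ hρ => (Finset.mem_filter.1 hρ).2
    have hsub : zeroCyl σ i \ Cyl W ⊆ Cyl (G' : Set (List Bool)) := by
      rintro X ⟨hX, hXW⟩
      refine mem_Cyl.2 ⟨L, Finset.mem_coe.2 (Finset.mem_filter.2 ⟨List.mem_toFinset.2 ?_,
        length_res _ _⟩)⟩
      rcases h _ (mem_allStr.2 (length_res X L)) with (h | h) | ⟨τ, h1, h2⟩
      · exact absurd (zeroCyl_subset hL hX) h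
      · exact h
      · refine absurd (cyl_subset_Cyl h2 ?_) hXW
        exact cyl_antitone (h1 ▸ List.take_prefix _ _) (mem_cyl_res X L)
    refine (measure_mono hsub).trans ((mu_Cyl_le _).trans ?_)
    rw [wt_finset hG', ← ENNReal.inv_pow, ← ENNReal.inv_pow, ← div_eq_mul_inv]
    refine ENNReal.div_le_of_le_mul ?_
    rw [mul_comm, ← div_eq_mul_inv, ENNReal.le_div_iff_mul_le (by simp) (by simp)]
    have : G'.card ≤ G.length := (Finset.card_filter_le _ _).trans (List.toFinset_card_le G)
    exact_mod_cast (Nat.mul_le_mul_right _ this).trans hlt.le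

theorem tsum_le_of_almost_covered {σ : List Bool} {V : Set (ℕ → Bool)} {J : Set ℕ} {m : ℕ}
    (hm : 4 * 2⁻¹ ^ m ≤ mu.real (cyl σ \ V))
    (hJ : ∀ i ∈ J, mu (zeroCyl σ i \ V) ≤ 2⁻¹ ^ (i + m)) :
    ∑' i : J, (2⁻¹ : ℝ≥0∞) ^ (i : ℕ).unpair.1 ≤ m := by
  rw [ENNReal.tsum_eq_iSup_sum]
  refine iSup_le fun F => ?_
  let E : Set (ℕ → Bool) := {X | (∀ j ∈ (∅ : Finset ℕ), X j = false) ∧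
    ∀ i ∈ F, ¬∀ j ∈ block σ.length i, X j = false}
  have hE : mu.real E = ∏ i ∈ F, (1 - 2⁻¹ ^ (i : ℕ).unpair.1) := by
    rw [mu_blocks (fun i : J => block σ.length i) F ∅ (by simp)
      fun i _ j _ hij => disjoint_block _ fun h => hij (Subtype.ext h)]
    simp [card_block]
  have hcov : cyl σ \ V ⊆ E ∪ ⋃ i ∈ F, zeroCyl σ i \ V := by
    rintro X ⟨hX, hXV⟩
    by_cases h : ∃ i ∈ F, ∀ j ∈ block σ.length i, X j = false
    · obtain ⟨i, hi, h⟩ := h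
      exact Or.inr (Set.mem_biUnion hi ⟨⟨hX, h⟩, hXV⟩)
    · push Not at h
      exact Or.inl ⟨by simp, fun i hi h' => by obtain ⟨j, hj, hne⟩ := h i hi; exact hne (h' j hj)⟩
  have herr : mu (⋃ i ∈ F, zeroCyl σ i \ V) ≤ 2 * 2⁻¹ ^ m :=
    calc _ ≤ ∑ i ∈ F, mu (zeroCyl σ i \ V) := measure_biUnion_finset_le _ _
      _ ≤ ∑ i ∈ F, 2⁻¹ ^ ((i : ℕ) + m) := Finset.sum_le_sum fun i _ => hJ i i.2
      _ ≤ ∑' i : J, 2⁻¹ ^ ((i : ℕ) + m) := ENNReal.sum_le_tsum _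
      _ ≤ ∑' i : ℕ, 2⁻¹ ^ (i + m) :=
        ENNReal.tsum_comp_le_tsum_of_injective Subtype.val_injective _
      _ = 2 * 2⁻¹ ^ m := by
        simp only [pow_add, ENNReal.tsum_mul_right, ENNReal.tsum_geometric,
          ENNReal.one_sub_inv_two, inv_inv]
  have herr' : mu.real (⋃ i ∈ F, zeroCyl σ i \ V) ≤ 2 * 2⁻¹ ^ m := by
    refine (ENNReal.toReal_mono (by finiteness) herr).trans (le_of_eq (by simp))
  have hprod : (2⁻¹ : ℝ) ^ m ≤ ∏ i ∈ F, (1 - 2⁻¹ ^ (i : ℕ).unpair.1) := by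
    have := (measureReal_mono (μ := mu) hcov).trans (measureReal_union_le _ _)
    have h0 : (0 : ℝ) ≤ 2⁻¹ ^ m := by positivity
    linarith
  have hexp : Real.exp (-m) ≤ Real.exp (-∑ i ∈ F, 2⁻¹ ^ (i : ℕ).unpair.1) :=
    calc Real.exp (-m) = Real.exp (-1) ^ m := by rw [← Real.exp_nat_mul]; simp
      _ ≤ 2⁻¹ ^ m := by
        refine pow_le_pow_left₀ (Real.exp_pos _).le ?_ m
        rw [Real.exp_neg]
        exact inv_anti₀ two_pos (by linarith [Real.add_one_le_exp 1])
      _ ≤ ∏ i ∈ F, (1 - 2⁻¹ ^ (i : ℕ).unpair.1) := hprod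
      _ ≤ ∏ i ∈ F, Real.exp (-2⁻¹ ^ (i : ℕ).unpair.1) := by
        refine Finset.prod_le_prod (fun i _ => ?_) fun i _ => Real.one_sub_le_exp_neg _
        exact sub_nonneg.2 (pow_le_one₀ (by norm_num) (by norm_num))
      _ = _ := by rw [← Real.exp_sum, Finset.sum_neg_distrib]
  have hsum := Real.exp_le_exp.1 hexp
  have : (∑ i ∈ F, (2⁻¹ : ℝ≥0∞) ^ (i : ℕ).unpair.1) =
      ENNReal.ofReal (∑ i ∈ F, 2⁻¹ ^ (i : ℕ).unpair.1) := by
    rw [ENNReal.ofReal_sum_of_nonneg fun i _ => by positivity]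
    refine Finset.sum_congr rfl fun i _ => ?_
    rw [ENNReal.ofReal_pow (by norm_num), ENNReal.ofReal_inv_of_pos two_pos]
    simp
  rw [this, ← ENNReal.ofReal_natCast]
  exact ENNReal.ofReal_le_ofReal (by linarith)

theorem LRle.exists_cover {u : OracleCode} (hu : UniversalPFM u) {A B : Set ℕ} (h : LRle A B)
    {I : Set ℕ} (hI : Sig (chi A) (· ∈ I))
    (hw : ∑' i : I, (2⁻¹ : ℝ≥0∞) ^ (i : ℕ).unpair.1 ≤ 2⁻¹) :
    ∃ J, I ⊆ J ∧ Sig (chi B) (· ∈ J) ∧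
      ∃ m : ℕ, ∑' i : J, (2⁻¹ : ℝ≥0∞) ^ (i : ℕ).unpair.1 ≤ m := by
  let W := compressible u (chi B) 1
  let S := ⋃ i : I, zeroBlock i
  have hW : mu (Cyl W) < 1 :=
    (mu_compressible_le hu.1 _ 1).trans_lt (by simp [ENNReal.inv_lt_one])
  have hWs : Sig (chi B) (· ∈ W) := (sig_compressible u (chi B)).comp
    (f := fun τ => (1, τ)) (Primrec.pair (Primrec.const 1) Primrec.id)
  have hS := mlTest_concats (sig_iUnion_zeroBlock hI) ((wt_iUnion_zeroBlock_le I).trans hw)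
  obtain ⟨σ, hσ, hnull⟩ := exists_cyl_of_avoid (S := S) hW fun X hX => by
    by_contra! hX'
    exact h X (random_of_not_mem_compressible hu hX) _ hS (Set.mem_iInter.2 hX')
  have hpos : 0 < mu.real (cyl σ \ Cyl W) := ENNReal.toReal_pos hσ (by finiteness)
  obtain ⟨m, hm⟩ := exists_pow_lt_of_lt_one (div_pos hpos four_pos)
    (by norm_num : (2⁻¹ : ℝ) < 1)
  obtain ⟨J, hJ, hIJ, hJm⟩ := exists_almost_covered hWs σ m
  refine ⟨J, fun i hi => hIJ i ?_, hJ, m, tsum_le_of_almost_covered (by linarith) hJm⟩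
  have hsub : zeroCyl σ i \ Cyl W ⊆ ⋃ ρ : zeroBlock i, cyl (σ ++ ρ) \ Cyl W := by
    rintro X ⟨hX, hXW⟩
    rw [Set.mem_iUnion]
    rw [zeroCyl, Set.mem_inter_iff, Set.mem_ofPred_eq, forall_mem_block] at hX
    obtain ⟨ρ, hρ⟩ := (mem_cyl_iff (Nat.le_add_right _ (Nat.pair i i.unpair.1))).1 hX.1
    have hlen : ρ.length = Nat.pair i i.unpair.1 := by
      simpa using congrArg List.length hρ
    refine ⟨⟨ρ, hlen, fun j hj => ?_⟩, ?_, hXW⟩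
    · have hlt := Nat.pair_lt_pair_right i hj
      rw [← hX.2 j hj, ← getElem?_res X (Nat.add_lt_add_left hlt σ.length), ← hρ,
        List.getElem?_append_right (Nat.le_add_right _ _), Nat.add_sub_cancel_left]
    · rw [hρ]
      exact mem_cyl_res X _
  exact measure_mono_null hsub (measure_iUnion_null fun ρ =>
    hnull ρ (Set.mem_iUnion.2 ⟨⟨i, hi⟩, ρ.2⟩))

theorem lk_of_lr {u : OracleCode} (hu : UniversalPFM u) {A B : Set ℕ} (h : LRle A B) :
    LKle u A B := by
  let I : Set ℕ := {i | ∃ x : List Bool × List Bool,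
    i = Nat.pair (x.1.length + 1) (Encodable.encode x.2) ∧ x.2 ∈ evalStr u (chi A) x.1}
  have hI : Sig (chi A) (· ∈ I) := by
    refine Sig.ex (P := fun (i : ℕ) (x : List Bool × List Bool) =>
      i = Nat.pair (x.1.length + 1) (Encodable.encode x.2) ∧ x.2 ∈ evalStr u (chi A) x.1)
      (Sig.and (Sig.of_primrec ?_) ((Sig.mem_evalStr u).comp Primrec.snd))
    exact Primrec.eq.comp Primrec.fst (Primrec₂.natPair.comp (Primrec.succ.comp
      (Primrec.list_length.comp (Primrec.fst.comp Primrec.snd)))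
      (Primrec.encode.comp (Primrec.snd.comp Primrec.snd)))
  have hw : ∑' i : I, (2⁻¹ : ℝ≥0∞) ^ (i : ℕ).unpair.1 ≤ 2⁻¹ := by
    choose x hx hmem using fun i : I => i.2
    have hinj : Function.Injective fun i => (x i).1 := by
      intro i j hij
      have : x i = x j := Prod.ext hij (Part.mem_unique (hmem i)
        (by have := hmem j; rwa [← show (x i).1 = (x j).1 from hij] at this))
      exact Subtype.ext ((hx i).trans (by rw [this, ← hx j]))
    have hle := hu.1.tsum_le (chi A) hinj fun i => (hmem i).fst
    calc _ = ∑' i, (2⁻¹ : ℝ≥0∞) ^ (x i).1.length * 2⁻¹ := tsum_congr fun i => by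
          rw [← pow_succ, hx i, Nat.unpair_pair]
      _ ≤ 2⁻¹ := by
        rw [ENNReal.tsum_mul_right]
        exact (mul_le_mul_left hle _).trans (one_mul _).le
  obtain ⟨J, hIJ, hJ, m, hm⟩ := h.exists_cover hu hI hw
  let P : Set (ℕ × List Bool) :=
    {q | ∃ n, q.1 = n + m ∧ Nat.pair n (Encodable.encode q.2) ∈ J}
  have hP : Sig (chi B) (· ∈ P) := by
    refine Sig.ex (P := fun (q : ℕ × List Bool) n => q.1 = n + m ∧
      Nat.pair n (Encodable.encode q.2) ∈ J) (Sig.and (Sig.of_primrec ?_) (hJ.comp ?_))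
    · exact Primrec.eq.comp (Primrec.fst.comp Primrec.fst)
        (Primrec.nat_add.comp Primrec.snd (Primrec.const m))
    · exact Primrec₂.natPair.comp Primrec.snd
        (Primrec.encode.comp (Primrec.snd.comp Primrec.fst))
  have hPw : ∑' q : P, (2⁻¹ : ℝ≥0∞) ^ q.1.1 ≤ 1 := by
    choose n hn hnJ using fun q : P => q.2
    let f : P → J := fun q => ⟨_, hnJ q⟩
    have hf : Function.Injective f := fun q r hqr => by
      have : Nat.pair (n q) _ = Nat.pair (n r) _ := congrArg Subtype.val hqr
      rw [Nat.pair_eq_pair, Encodable.encode_inj] at this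
      exact Subtype.ext (Prod.ext (by rw [hn q, hn r, this.1]) this.2)
    calc _ = ∑' q, (2⁻¹ : ℝ≥0∞) ^ (f q : ℕ).unpair.1 * 2⁻¹ ^ m := tsum_congr fun q => by
          rw [← pow_add, Nat.unpair_pair, hn q]
      _ ≤ 2 ^ m * 2⁻¹ ^ (0 + m) := by
        rw [ENNReal.tsum_mul_right, zero_add]
        refine mul_le_mul_left (((ENNReal.tsum_comp_le_tsum_of_injective hf
          fun i : J => (2⁻¹ : ℝ≥0∞) ^ (i : ℕ).unpair.1).trans hm).trans ?_) _
        exact_mod_cast Nat.lt_two_pow_self.le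
      _ ≤ 1 := by rw [two_pow_mul_two_inv_pow, pow_zero]
  obtain ⟨d, hd⟩ := kraft_chaitin hu hP hPw
  refine lkle_iff.2 ⟨1 + m + d, fun τ p hp => ?_⟩
  obtain ⟨p', hp', hl⟩ := hd (p.length + 1 + m, τ) ⟨p.length + 1, rfl, hIJ ⟨(p, τ), rfl, hp⟩⟩
  exact ⟨p', hp', by simp only at hl; omega⟩

/-- `A ≤_LR B` if and only if `A ≤_LK B` (for any universal prefix-free oracle machine). -/
theorem lr_iff_lk (u : OracleCode) (hu : UniversalPFM u) (A B : Set ℕ) :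
    LRle A B ↔ LKle u A B :=
  ⟨lk_of_lr hu, lr_of_lk hu⟩

end LMD
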